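/- For every n ≥ 1, if F_n denotes the free group on n generators with its standard marking, then the graph G(F_n, ℕ) is a 2n-regular acyclic Borel graph with Borel chromatic number χ_B(G(F_n, ℕ)) = 2n + 1. -/

import Mathlib

/-- The left shift action of a group `G` on the product space `G → X`:
`(γ • y) β = y (γ⁻¹ * β)`. -/
def shift {G : Type*} [Group G] {X : Type*} (γ : G) (y : G → X) : G → X :=
  fun β => y (γ⁻¹ * β)

/-- The free part `Free(X^G)` of the left shift action of `G` on `G → X`. -/
def freePart (G : Type*) [Group G] (X : Type*) : Set (G → X) :=
  {y | ∀ γ : G, γ ≠ 1 → shift γ y ≠ y}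

/-- The Borel chromatic number of a (graph given by a) relation `G` on a measurable
space `X`: the least cardinality of a standard Borel space `Y` admitting a Borel
(measurable) coloring `c : X → Y` with `c x ≠ c y` whenever `G x y`. -/
noncomputable def borelChromaticNumber {X : Type} [mX : MeasurableSpace X]
    (G : X → X → Prop) : Cardinal :=
  sInf {κ : Cardinal | ∃ (Y : Type) (mY : MeasurableSpace Y),
    @StandardBorelSpace Y mY ∧ Cardinal.mk Y = κ ∧
    ∃ c : X → Y, @Measurable X Y mX mY c ∧ ∀ x y, G x y → c x ≠ c y}

/-- The adjacency relation of the graph `G(Γ, X)` on the free part `Free(X^Γ)` determined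
by a set `S` of generators of `Γ`: `x` and `y` are adjacent iff some `γ ∈ S` shifts `x`
to `y` or `y` to `x`. -/
def cayleyAdj {Γ : Type} [Group Γ] (S : Set Γ) (X : Type) :
    ↥(freePart Γ X) → ↥(freePart Γ X) → Prop :=
  fun x y => ∃ γ ∈ S,
    shift γ (x : Γ → X) = (y : Γ → X) ∨ shift γ (y : Γ → X) = (x : Γ → X)

/-- A pruned forest of positions, graded by length: every position has a parent, and every
position has a child. -/
structure GameForest where
  Pos : ℕ → Type
  par : ∀ {n}, Pos (n + 1) → Pos n
  par_surj : ∀ n, Function.Surjective (par : Pos (n + 1) → Pos n)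

namespace GameForest

/-- An infinite branch of the forest. -/
structure Run (T : GameForest) where
  pos : ∀ n, T.Pos n
  par_eq : ∀ n, T.par (pos (n + 1)) = pos n

instance (T : GameForest) : CoeFun T.Run (fun _ => ∀ n, T.Pos n) := ⟨Run.pos⟩

/-- A choice of a child at every position. -/
abbrev Strat (T : GameForest) : Type :=
  ∀ n (p : T.Pos n), {q : T.Pos (n + 1) // T.par q = p}

/-- The forest obtained by dropping the first level. -/
def tail (T : GameForest) : GameForest where
  Pos n := T.Pos (n + 1)
  par := T.par
  par_surj n := T.par_surj (n + 1)

variable {T : GameForest}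

@[ext] theorem Run.ext {x y : T.Run} (h : ∀ n, x n = y n) : x = y := by
  cases x; cases y; congr; exact funext h

theorem Run.eq_of_le {x y : T.Run} {m n : ℕ} (hmn : m ≤ n) (h : x n = y n) : x m = y m := by
  induction hmn with
  | refl => exact h
  | step _ ih => exact ih (by rw [← x.par_eq, ← y.par_eq, h])

theorem Strat.exists_run (T : GameForest) (σ : T.Strat) (n : ℕ) (p : T.Pos n) :
    ∃ x : T.Run, x n = p ∧ ∀ j ≥ n, x (j + 1) = σ j (x j) := by
  induction n generalizing T with
  | zero =>
    let x : ∀ j, T.Pos j := fun j => Nat.rec p (fun j q => (σ j q).1) j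
    exact ⟨⟨x, fun j => (σ j (x j)).2⟩, rfl, fun j _ => rfl⟩
  | succ n ih =>
    obtain ⟨y, hy, hj⟩ := ih T.tail (fun j q => σ (j + 1) q) p
    let x : ∀ j, T.Pos j := fun j => Nat.casesOn j (T.par (y 0)) (fun j => y j)
    refine ⟨⟨x, fun j => ?_⟩, hy, fun j hjn => ?_⟩
    · cases j with
      | zero => rfl
      | succ j => exact y.2 j
    · cases j with
      | zero => omega
      | succ j => exact hj j (by omega)

/-- An arbitrary strategy. -/
noncomputable def anyStrat (T : GameForest) : T.Strat := fun n p =>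
  ⟨(T.par_surj n p).choose, (T.par_surj n p).choose_spec⟩

/-- The ancestor at level `m` of a position at level `n ≥ m`. -/
noncomputable def anc (m : ℕ) {n : ℕ} (p : T.Pos n) : T.Pos m :=
  (Strat.exists_run T T.anyStrat n p).choose m

theorem anc_run (x : T.Run) {m n : ℕ} (h : m ≤ n) : anc m (x n) = x m :=
  Run.eq_of_le h (Strat.exists_run T T.anyStrat n (x n)).choose_spec.1

/-- `x` follows `σ` from level `n` on, at the levels of player `ρ`: `false` moves at even
levels, and `true` at odd levels. -/
def Follows (ρ : Bool) (σ : T.Strat) (n : ℕ) (x : T.Run) : Prop :=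
  ∀ j ≥ n, j.bodd = ρ → x (j + 1) = σ j (x j)

theorem exists_run_of (Q : ∀ n, T.Pos n → Prop) {n : ℕ} {p : T.Pos n} (hp : Q n p)
    (h : ∀ j ≥ n, ∀ p, Q j p → ∃ q, T.par q = p ∧ Q (j + 1) q) :
    ∃ x : T.Run, x n = p ∧ ∀ j ≥ n, Q j (x j) := by
  classical
  let σ : T.Strat := fun j p => if h : ∃ q, T.par q = p ∧ Q (j + 1) q then
    ⟨h.choose, h.choose_spec.1⟩ else T.anyStrat j p
  obtain ⟨x, hx, hxj⟩ := Strat.exists_run T σ n p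
  refine ⟨x, hx, fun j hj => ?_⟩
  induction j, hj using Nat.le_induction with
  | base => rwa [hx]
  | succ j hj ih =>
    have := h j hj _ ih
    rw [hxj j hj]
    simp only [σ, dif_pos this]
    exact this.choose_spec.2

/-- Player `ρ` can force the run to meet the target after `p`. -/
def Win (ρ : Bool) (tgt : ∀ n, T.Pos n → Prop) (n : ℕ) (p : T.Pos n) : Prop :=
  ∃ σ : T.Strat, ∀ x : T.Run, x n = p → Follows ρ σ n x → ∃ j ≥ n, tgt j (x j)

variable {ρ : Bool} {tgt : ∀ n, T.Pos n → Prop} {n : ℕ} {p : T.Pos n}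

theorem Win.of_target (h : tgt n p) : Win ρ tgt n p :=
  ⟨T.anyStrat, fun _ hx _ => ⟨n, le_rfl, hx ▸ h⟩⟩

theorem Win.exists_run (h : Win ρ tgt n p) : ∃ x : T.Run, x n = p ∧ ∃ j ≥ n, tgt j (x j) := by
  obtain ⟨σ, hσ⟩ := h
  obtain ⟨x, hx, hj⟩ := Strat.exists_run T σ n p
  exact ⟨x, hx, hσ x hx fun j h _ => hj j h⟩

theorem Win.of_child (hn : n.bodd = ρ) {q : T.Pos (n + 1)} (hq : T.par q = p)
    (h : Win ρ tgt (n + 1) q) : Win ρ tgt n p := by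
  classical
  obtain ⟨σ, hσ⟩ := h
  refine ⟨Function.update σ n (Function.update (σ n) p ⟨q, hq⟩), fun x hx hf => ?_⟩
  have h1 := hf n le_rfl hn
  rw [hx] at h1
  simp only [Function.update_self] at h1
  obtain ⟨j, hj, ht⟩ := hσ x h1 fun j hj hjρ => by
    have := hf j (by omega) hjρ
    rwa [Function.update_of_ne (by omega)] at this
  exact ⟨j, by omega, ht⟩

theorem Win.of_children (h : ∀ q, T.par q = p → Win ρ tgt (n + 1) q) : Win ρ tgt n p := by
  classical
  choose σ hσ using h
  refine ⟨fun j r => if h : T.par (anc (n + 1) r) = p then σ _ h j r else T.anyStrat j r,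
    fun x hx hf => ?_⟩
  have hp : T.par (x (n + 1)) = p := by rw [x.par_eq, hx]
  obtain ⟨j, hj, ht⟩ := hσ _ hp x rfl fun j hj hjρ => by
    have := hf j (by omega) hjρ
    have ha : anc (n + 1) (x j) = x (n + 1) := anc_run x hj
    simp only [ha, dif_pos hp] at this
    exact this
  exact ⟨j, by omega, ht⟩

theorem Win.exists_child (h : ¬ Win ρ tgt n p) :
    ∃ q, T.par q = p ∧ ¬ Win ρ tgt (n + 1) q := by
  by_contra! hc
  exact h (Win.of_children hc)

/-- Follow `σA` outside the region where the target can be forced, then force the target, and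
follow `σB m` after the target is first met at level `m`. -/
noncomputable def combine (ρ : Bool) (K : ℕ) (tgt : ∀ n, T.Pos n → Prop)
    (σB : ∀ m, T.Pos m → T.Strat) (σA : T.Strat) : T.Strat :=
  open Classical in fun n p =>
  if hB : ∃ m, m ≤ n ∧ tgt m (anc m p) then σB (Nat.find hB) (anc (Nat.find hB) p) n p
  else if hW : ∃ m, m ≤ n ∧ K ≤ m ∧ Win ρ tgt m (anc m p) then
    (Nat.find_spec hW).2.2.choose n p
  else σA n p

theorem combine_spec {K : ℕ} {σB : ∀ m, T.Pos m → T.Strat} {σA : T.Strat} {x : T.Run}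
    (hx : Follows ρ (combine ρ K tgt σB σA) K x) :
    ((∀ j ≥ K, ¬ Win ρ tgt j (x j)) ∧ Follows ρ σA K x) ∨
    ∃ m, tgt m (x m) ∧ ∀ j ≥ K, m ≤ j → j.bodd = ρ → x (j + 1) = σB m (x m) j (x j) := by
  classical
  by_cases ht : ∃ m, tgt m (x m)
  · right
    refine ⟨Nat.find ht, Nat.find_spec ht, fun j hjK hj hjρ => ?_⟩
    have hB : ∃ m, m ≤ j ∧ tgt m (anc m (x j)) :=
      ⟨Nat.find ht, hj, by rw [anc_run x hj]; exact Nat.find_spec ht⟩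
    have hfind : Nat.find hB = Nat.find ht := by
      have h1 : Nat.find hB ≤ Nat.find ht :=
        Nat.find_min' _ ⟨hj, by rw [anc_run x hj]; exact Nat.find_spec ht⟩
      refine le_antisymm h1 (Nat.find_min' _ ?_)
      have := (Nat.find_spec hB).2
      rwa [anc_run x (h1.trans hj)] at this
    rw [hx j hjK hjρ]
    simp only [combine, dif_pos hB]
    rw [hfind, anc_run x hj]
  · left
    have hB : ∀ j, ¬ ∃ m, m ≤ j ∧ tgt m (anc m (x j)) := by
      rintro j ⟨m, hm, h⟩
      rw [anc_run x hm] at h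
      exact ht ⟨m, h⟩
    have hW : ¬ ∃ j, K ≤ j ∧ Win ρ tgt j (x j) := by
      intro hW
      set m := Nat.find hW with hm
      have hmK := (Nat.find_spec hW).1
      have hmW := (Nat.find_spec hW).2
      rw [← hm] at hmK hmW
      have key : ∀ {m'} (_ : m' = m) {q : T.Pos m'} (_ : q = x m') (h : Win ρ tgt m' q) {j},
          (h.choose j (x j)).1 = hmW.choose j (x j) := by
        rintro _ rfl _ rfl _ _
        rfl
      obtain ⟨j, -, hj⟩ := hmW.choose_spec x rfl fun j hj hjρ => by
        rw [hx j (hmK.trans hj) hjρ]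
        have hW' : ∃ m, m ≤ j ∧ K ≤ m ∧ Win ρ tgt m (anc m (x j)) :=
          ⟨m, hj, hmK, by rw [anc_run x hj]; exact hmW⟩
        have hfind : Nat.find hW' = m := by
          have h1 : Nat.find hW' ≤ m :=
            Nat.find_min' _ ⟨hj, hmK, by rw [anc_run x hj]; exact hmW⟩
          refine le_antisymm h1 (Nat.find_min' _ ?_)
          have := (Nat.find_spec hW').2
          rwa [anc_run x (h1.trans hj)] at this
        simp only [combine, dif_neg (hB j), dif_pos hW']
        exact key hfind (anc_run x (hfind.le.trans hj)) _
      exact ht ⟨j, hj⟩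
    refine ⟨fun j hj h => hW ⟨j, hj, h⟩, fun j hj hjρ => ?_⟩
    rw [hx j hj hjρ]
    have : ¬ ∃ m, m ≤ j ∧ K ≤ m ∧ Win ρ tgt m (anc m (x j)) := by
      rintro ⟨m, hm, hK, h⟩
      rw [anc_run x hm] at h
      exact hW ⟨m, hK, h⟩
    simp only [combine, dif_neg (hB j), dif_neg this]

end GameForest

namespace GameForest

/-- A level-preserving map of forests. -/
structure Hom (T' T : GameForest) where
  map : ∀ n, T'.Pos n → T.Pos n
  par_map : ∀ n q, T.par (map (n + 1) q) = map n (T'.par q)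

/-- The map induced by a map of forests on infinite branches. -/
def Hom.run {T' T : GameForest} (f : Hom T' T) (x : T'.Run) : T.Run where
  pos n := f.map n (x n)
  par_eq n := by rw [f.par_map, x.par_eq]

/-- The composition of two maps of forests. -/
def Hom.comp {T'' T' T : GameForest} (f : Hom T' T) (g : Hom T'' T') : Hom T'' T where
  map n := f.map n ∘ g.map n
  par_map n q := by simp [f.par_map, g.par_map]

/-- The identity map of a forest. -/
def Hom.id (T : GameForest) : Hom T T where
  map _ p := p
  par_map _ _ := rfl

/-- Martin's coverings: a map of forests, bijective up to level `K`, along which strategies can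
be pushed forward level by level so that every play following the image strategy lifts to a
play following the original one. -/
structure Cover (K : ℕ) (T' T : GameForest) extends Hom T' T where
  bij : ∀ n ≤ K, Function.Bijective (map n)
  strat : Bool → T'.Strat → T.Strat
  strat_congr : ∀ ρ n σ τ, (∀ m ≤ n, σ m = τ m) → strat ρ σ n = strat ρ τ n
  strat_map : ∀ ρ σ n, n < K → ∀ p, (strat ρ σ n (map n p)).1 = map (n + 1) (σ n p)
  lift : ∀ ρ σ x, Follows ρ (strat ρ σ) 0 x → ∃ y, Follows ρ σ 0 y ∧ toHom.run y = x

/-- The identity covering. -/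
def Cover.id (K : ℕ) (T : GameForest) : Cover K T T where
  toHom := Hom.id T
  bij _ _ := Function.bijective_id
  strat _ σ := σ
  strat_congr _ n _ _ h := h n le_rfl
  strat_map _ _ _ _ _ := rfl
  lift _ _ x h := ⟨x, h, rfl⟩

/-- The composition of two coverings. -/
def Cover.comp {K : ℕ} {T'' T' T : GameForest} (f : Cover K T' T) (g : Cover K T'' T') :
    Cover K T'' T where
  toHom := f.toHom.comp g.toHom
  bij n hn := (f.bij n hn).comp (g.bij n hn)
  strat ρ σ := f.strat ρ (g.strat ρ σ)
  strat_congr ρ n σ τ h := f.strat_congr ρ n _ _ fun m hm =>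
    g.strat_congr ρ m _ _ fun i hi => h i (hi.trans hm)
  strat_map ρ σ n hn p := by
    simp only [Hom.comp, Function.comp_apply]
    rw [f.strat_map ρ _ n hn, g.strat_map ρ _ n hn]
  lift ρ σ x h := by
    obtain ⟨y, hy, rfl⟩ := f.lift ρ _ x h
    obtain ⟨z, hz, rfl⟩ := g.lift ρ _ y hy
    exact ⟨z, hz, rfl⟩

theorem exists_thread {P : ℕ → Type} (π : ∀ i, P (i + 1) → P i) (j : ℕ) (a : P j)
    (h : ∀ i ≥ j, Function.Surjective (π i)) :
    ∃ t : ∀ i, P i, (∀ i, π i (t (i + 1)) = t i) ∧ t j = a := by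
  induction j generalizing P with
  | zero =>
    choose g hg using fun i => h i (Nat.zero_le i)
    exact ⟨fun i => Nat.rec a (fun i b => g i b) i, fun i => hg i _, rfl⟩
  | succ j ih =>
    obtain ⟨t, ht, hj⟩ := ih (P := fun i => P (i + 1)) (fun i => π (i + 1)) a
      fun i hi => h (i + 1) (by omega)
    refine ⟨fun i => Nat.casesOn i (π 0 (t 0)) fun i => t i, fun i => ?_, hj⟩
    cases i with
    | zero => rfl
    | succ i => exact ht i

section Limit

variable {T : ℕ → GameForest} {k : ℕ → ℕ}

/-- Compatible sequences of positions in an inverse system of coverings. -/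
def Thread (c : ∀ i, Cover (k i) (T (i + 1)) (T i)) (n : ℕ) : Type :=
  {t : ∀ i, (T i).Pos n // ∀ i, (c i).map n (t (i + 1)) = t i}

variable {c : ∀ i, Cover (k i) (T (i + 1)) (T i)}

theorem Thread.ext_of_le (hk : Monotone k) {n j : ℕ} (hn : n ≤ k j) {t t' : Thread c n}
    (h : t.1 j = t'.1 j) : t = t' := by
  have up : ∀ i ≥ j, t.1 i = t'.1 i := fun i hi => by
    induction i, hi using Nat.le_induction with
    | base => exact h
    | succ i hi ih =>
      refine ((c i).bij n (hn.trans (hk hi))).1 ?_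
      rw [t.2, t'.2, ih]
  have down : ∀ d i, t.1 (i + d) = t'.1 (i + d) → t.1 i = t'.1 i := fun d => by
    induction d with
    | zero => exact fun _ h => h
    | succ d ih =>
      intro i h
      refine ih i ?_
      rw [← t.2, ← t'.2]
      exact congrArg _ h
  exact Subtype.ext (funext fun i => down j i (up (i + j) (by omega)))

theorem Thread.exists_of_le (hk : Monotone k) {n j : ℕ} (hn : n ≤ k j) (a : (T j).Pos n) :
    ∃ t : Thread c n, t.1 j = a := by
  obtain ⟨t, ht, hj⟩ := exists_thread (P := fun i => (T i).Pos n) (fun i => (c i).map n) j a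
    fun i hi => ((c i).bij n (hn.trans (hk hi))).2
  exact ⟨⟨t, ht⟩, hj⟩

/-- The inverse limit of a sequence of coverings. -/
def limit (c : ∀ i, Cover (k i) (T (i + 1)) (T i)) (hk : Monotone k) (hlt : ∀ i, i < k i) :
    GameForest where
  Pos := Thread c
  par t := ⟨fun i => (T i).par (t.1 i), fun i => by rw [← (c i).par_map, t.2]⟩
  par_surj n p := by
    obtain ⟨q, hq⟩ := (T (n + 1)).par_surj n (p.1 (n + 1))
    obtain ⟨t, ht⟩ := Thread.exists_of_le (c := c) hk (hlt (n + 1)).le q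
    refine ⟨t, Thread.ext_of_le hk (j := n + 1) (by have := hlt (n + 1); omega) ?_⟩
    simp only [ht, hq]

variable (c) (hk : Monotone k) (hlt : ∀ i, i < k i)

/-- The projection of the inverse limit to a stage. -/
def limitProj (i : ℕ) : Hom (limit c hk hlt) (T i) where
  map _ t := t.1 i
  par_map _ _ := rfl

open Classical in
/-- The strategy induced at a stage by a strategy on the inverse limit, meaningful at the levels
which are already stable. -/
noncomputable def stageStrat (σ : (limit c hk hlt).Strat) (j : ℕ) : (T j).Strat := fun n p =>
  if h : ∃ t : Thread c n, t.1 j = p then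
    ⟨(σ n h.choose).1.1 j, by
      have := congrArg (fun t : Thread c n => t.1 j) (σ n h.choose).2
      exact Eq.trans this h.choose_spec⟩
  else (T j).anyStrat n p

variable {c hk hlt}

theorem stageStrat_apply (σ : (limit c hk hlt).Strat) {j n : ℕ} (hn : n ≤ k j) (t : Thread c n) :
    (stageStrat c hk hlt σ j n (t.1 j)).1 = (σ n t).1.1 j := by
  have h : ∃ t' : Thread c n, t'.1 j = t.1 j := ⟨t, rfl⟩
  have ht : h.choose = t := Thread.ext_of_le hk hn h.choose_spec
  simp only [stageStrat, dif_pos h]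
  rw [ht]

variable (c hk hlt)

/-- Iterated images, at all stages, of the strategies induced by a strategy on the limit. -/
noncomputable def stageIter (ρ : Bool) (σ : (limit c hk hlt).Strat) : ℕ → ∀ i, (T i).Strat
  | 0, i => stageStrat c hk hlt σ i
  | r + 1, i => (c i).strat ρ (stageIter ρ σ r (i + 1))

/-- The eventual value of the iterated images. -/
noncomputable def stageLim (ρ : Bool) (σ : (limit c hk hlt).Strat) (i : ℕ) : (T i).Strat :=
  fun n => stageIter c hk hlt ρ σ n i n

variable {c hk hlt} {ρ : Bool} {σ τ : (limit c hk hlt).Strat}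

theorem stageIter_succ (r i n : ℕ) (hn : n < k (i + r)) :
    stageIter c hk hlt ρ σ (r + 1) i n = stageIter c hk hlt ρ σ r i n := by
  induction r generalizing i n with
  | zero =>
    funext p
    obtain ⟨t, rfl⟩ := Thread.exists_of_le (c := c) hk (show n ≤ k i from hn.le) p
    apply Subtype.ext
    simp only [stageIter]
    rw [stageStrat_apply σ (show n ≤ k i from hn.le), ← t.2 i, (c i).strat_map ρ _ n hn,
      stageStrat_apply σ (show n ≤ k (i + 1) from hn.le.trans (hk (by omega)))]
    exact (σ n t).1.2 i
  | succ r ih =>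
    refine (c i).strat_congr ρ n _ _ fun m hm => ih (i + 1) m ?_
    rw [show i + 1 + r = i + (r + 1) by omega]
    omega

theorem stageIter_eq_of_le {i n r r' : ℕ} (hr : r ≤ r') (hn : n < k (i + r)) :
    stageIter c hk hlt ρ σ r' i n = stageIter c hk hlt ρ σ r i n := by
  induction r', hr using Nat.le_induction with
  | base => rfl
  | succ r' hr ih =>
    rw [stageIter_succ _ _ _ (hn.trans_le (hk (by omega))), ih]

theorem stageIter_eq_stageLim {i n r : ℕ} (hr : n ≤ r) :
    stageIter c hk hlt ρ σ r i n = stageLim c hk hlt ρ σ i n :=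
  stageIter_eq_of_le hr ((hlt n).trans_le (hk (by omega)))

theorem strat_stageLim (i : ℕ) :
    (c i).strat ρ (stageLim c hk hlt ρ σ (i + 1)) = stageLim c hk hlt ρ σ i := by
  funext n
  rw [← stageIter_eq_stageLim (Nat.le_succ n)]
  exact (c i).strat_congr ρ n _ _ fun m hm => (stageIter_eq_stageLim hm).symm

theorem stageLim_eq_stageStrat {i n : ℕ} (hn : n < k i) :
    stageLim c hk hlt ρ σ i n = stageStrat c hk hlt σ i n :=
  stageIter_eq_of_le (r := 0) (Nat.zero_le n) hn

theorem stageIter_congr {n : ℕ} (h : ∀ m ≤ n, σ m = τ m) (r i : ℕ) :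
    ∀ m ≤ n, stageIter c hk hlt ρ σ r i m = stageIter c hk hlt ρ τ r i m := by
  induction r generalizing i with
  | zero =>
    intro m hm
    funext p
    simp only [stageIter, stageStrat, h m hm]
  | succ r ih =>
    exact fun m hm => (c i).strat_congr ρ m _ _ fun m' hm' => ih (i + 1) m' (hm'.trans hm)

/-- The inverse limit covers the first stage. -/
noncomputable def limitCover {K : ℕ} (hK : K ≤ k 0) : Cover K (limit c hk hlt) (T 0) where
  toHom := limitProj c hk hlt 0
  bij n hn := ⟨fun _ _ h => Thread.ext_of_le hk (hn.trans hK) h,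
    fun a => Thread.exists_of_le hk (hn.trans hK) a⟩
  strat ρ σ := stageLim c hk hlt ρ σ 0
  strat_congr ρ n σ τ h := stageIter_congr h n 0 n le_rfl
  strat_map ρ σ n hn p := by
    rw [stageLim_eq_stageStrat (hn.trans_le hK)]
    exact stageStrat_apply σ (hn.le.trans hK) p
  lift ρ σ x hx := by
    have step : ∀ i (y : {y : (T i).Run // Follows ρ (stageLim c hk hlt ρ σ i) 0 y}),
        ∃ z : {z : (T (i + 1)).Run // Follows ρ (stageLim c hk hlt ρ σ (i + 1)) 0 z},
          (c i).run z.1 = y.1 := by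
      rintro i ⟨y, hy⟩
      rw [← strat_stageLim] at hy
      obtain ⟨z, hz, hzy⟩ := (c i).lift ρ _ y hy
      exact ⟨⟨z, hz⟩, hzy⟩
    choose g hg using step
    let y : ∀ i, {y : (T i).Run // Follows ρ (stageLim c hk hlt ρ σ i) 0 y} :=
      fun i => Nat.rec ⟨x, hx⟩ (fun i y => g i y) i
    have hy : ∀ i, (c i).run (y (i + 1)).1 = (y i).1 := fun i => hg i (y i)
    let z : (limit c hk hlt).Run :=
      { pos := fun n => ⟨fun i => (y i).1 n, fun i => congrArg (fun r : (T i).Run => r n) (hy i)⟩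
        par_eq := fun n => Subtype.ext (funext fun i => (y i).1.par_eq n) }
    refine ⟨z, fun n _ hn => ?_, rfl⟩
    refine Thread.ext_of_le hk (j := n + 1) (hlt (n + 1)).le ?_
    have h1 := (y (n + 1)).2 n (Nat.zero_le _) hn
    have hlt' : n < k (n + 1) := by have := hlt (n + 1); omega
    rw [stageLim_eq_stageStrat hlt'] at h1
    exact h1.trans (stageStrat_apply σ hlt'.le (z n))

end Limit

end GameForest

namespace GameForest

section Unravel

variable {T : GameForest} (N : ∀ n, T.Pos n → Prop) (K : ℕ)

/-- The type of sets of positions. -/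
abbrev Target (T : GameForest) : Type := ∀ n, T.Pos n → Prop

/-- The positions in `N` of length at least `K + 2` reached without entering the region where
player `true` can force `U`. -/
def escape (U : Target T) : Target T := fun m u =>
  K + 2 ≤ m ∧ N m u ∧ ∀ j, K + 1 ≤ j → j ≤ m → ¬ Win true U j (anc j u)

/-- The decorated runs of the unravelling. -/
def Decorated (x : T.Run) (U : Target T) : Option (Σ m, T.Pos m) → Prop
  | none => (∀ j ≥ K + 1, ¬ Win true U j (x j)) ∧ ∀ j ≥ K + 2, ¬ Win false (escape N K U) j (x j)
  | some v => x v.1 = v.2 ∧ escape N K U v.1 v.2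

open Classical in
/-- The part of a decorated run which is visible at level `n`. -/
noncomputable def decode (n : ℕ) (p : T.Pos n) (U : Target T) (f : Option (Σ m, T.Pos m)) :
    T.Pos n × Target T × Option (Σ m, T.Pos m) :=
  (p, if n ≤ K then fun _ _ => False else U, if n ≤ K + 1 then none else f)

/-- The positions of the unravelling. -/
def IsDecorated (n : ℕ) (t : T.Pos n × Target T × Option (Σ m, T.Pos m)) : Prop :=
  ∃ (x : T.Run) (U : Target T) (f : Option (Σ m, T.Pos m)),
    Decorated N K x U f ∧ decode K n (x n) U f = t

variable {N K}

theorem decode_par {n : ℕ} (p : T.Pos (n + 1)) (U f) :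
    decode K n (T.par (decode K (n + 1) p U f).1) (decode K (n + 1) p U f).2.1
      (decode K (n + 1) p U f).2.2 = decode K n (T.par p) U f := by
  simp only [decode, Prod.mk.injEq, true_and]
  constructor <;> split_ifs <;> first | rfl | omega

variable (N K)

/-- The unravelling of the closed set of runs avoiding `N`. -/
noncomputable def unravel : GameForest where
  Pos n := {t // IsDecorated N K n t}
  par {n} t := ⟨decode K n (T.par t.1.1) t.1.2.1 t.1.2.2, by
    obtain ⟨_, x, U, f, h, rfl⟩ := t
    exact ⟨x, U, f, h, by rw [decode_par, x.par_eq]⟩⟩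
  par_surj n t := by
    obtain ⟨_, x, U, f, h, rfl⟩ := t
    exact ⟨⟨_, x, U, f, h, rfl⟩, Subtype.ext (by simp only [decode_par, x.par_eq])⟩

/-- Forgetting decorations. -/
noncomputable def unravelHom : Hom (unravel N K) T where
  map _ t := t.1.1
  par_map _ _ := rfl

variable {N K}

/-- The run of the unravelling given by a decorated run. -/
noncomputable def Decorated.run {x : T.Run} {U f} (h : Decorated N K x U f) :
    (unravel N K).Run where
  pos n := ⟨decode K n (x n) U f, x, U, f, h, rfl⟩
  par_eq n := Subtype.ext (by simp only [unravel, decode_par, x.par_eq])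

variable {x : T.Run} {U : Target T} {f : Option (Σ m, T.Pos m)}

theorem exists_safe {n : ℕ} {p : T.Pos n} {U V : Target T} (hU : ¬ Win true U n p)
    (hV : ¬ Win false V n p) :
    ∃ x : T.Run, x n = p ∧ ∀ j ≥ n, ¬ Win true U j (x j) ∧ ¬ Win false V j (x j) := by
  refine exists_run_of (fun j p => ¬ Win true U j p ∧ ¬ Win false V j p) ⟨hU, hV⟩
    fun j _ p ⟨h1, h2⟩ => ?_
  cases hj : j.bodd with
  | false =>
    obtain ⟨q, hq, h⟩ := Win.exists_child h1
    exact ⟨q, hq, h, fun h' => h2 (h'.of_child hj hq)⟩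
  | true =>
    obtain ⟨q, hq, h⟩ := Win.exists_child h2
    exact ⟨q, hq, fun h' => h1 (h'.of_child hj hq), h⟩

theorem isDecorated_none {j : ℕ} (hj : K + 2 ≤ j)
    (hU : ∀ i ≥ K + 1, i ≤ j → ¬ Win true U i (x i))
    (hV : ∀ i ≥ K + 2, i ≤ j → ¬ Win false (escape N K U) i (x i)) :
    IsDecorated N K j (decode K j (x j) U none) := by
  obtain ⟨y, hy, h⟩ := exists_safe (hU j (by omega) le_rfl) (hV j hj le_rfl)
  refine ⟨y, U, none, ⟨fun i hi => ?_, fun i hi => ?_⟩, by rw [hy]⟩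
  · rcases le_total i j with hij | hij
    · rw [Run.eq_of_le hij hy]
      exact hU i hi hij
    · exact (h i hij).1
  · rcases le_total i j with hij | hij
    · rw [Run.eq_of_le hij hy]
      exact hV i hi hij
    · exact (h i hij).2

theorem exists_decorated {p : T.Pos (K + 1)} (hU : ¬ Win true U (K + 1) p) :
    ∃ (x : T.Run) (f : _), x (K + 1) = p ∧ Decorated N K x U f := by
  by_cases hV : Win false (escape N K U) (K + 1) p
  · obtain ⟨x, hx, j, hj, h⟩ := hV.exists_run
    exact ⟨x, some ⟨j, x j⟩, hx, rfl, h⟩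
  · obtain ⟨x, hx, h⟩ := exists_safe hU hV
    exact ⟨x, none, hx, fun j hj => (h j hj).1, fun j hj => (h j (by omega)).2⟩

theorem isDecorated_root {p : T.Pos (K + 1)} (hU : ¬ Win true U (K + 1) p)
    (f : Option (Σ m, T.Pos m)) : IsDecorated N K (K + 1) (decode K (K + 1) p U f) := by
  obtain ⟨x, f, hx, h⟩ := exists_decorated (N := N) hU
  exact ⟨x, U, f, h, by simp [decode, hx]⟩

theorem not_win_empty (n : ℕ) (p : T.Pos n) : ¬ Win true (fun _ _ => False) n p := fun h => by
  obtain ⟨x, -, j, -, hj⟩ := h.exists_run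
  exact hj

theorem isDecorated_le {n : ℕ} (hn : n ≤ K) (p : T.Pos n) (U : Target T)
    (f : Option (Σ m, T.Pos m)) : IsDecorated N K n (decode K n p U f) := by
  obtain ⟨y, hy, -⟩ := Strat.exists_run T T.anyStrat n p
  obtain ⟨x, f, hx, h⟩ := exists_decorated (N := N) (not_win_empty (K + 1) (y (K + 1)))
  refine ⟨x, _, f, h, ?_⟩
  have : x n = p := by rw [Run.eq_of_le (show n ≤ K + 1 by omega) hx, hy]
  simp [decode, this, hn, show n ≤ K + 1 by omega]

theorem decode_eq_of_isDecorated {n : ℕ} {t} (ht : IsDecorated N K n t) :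
    decode K n t.1 t.2.1 t.2.2 = t := by
  obtain ⟨x, U, f, -, rfl⟩ := ht
  simp only [decode, Prod.mk.injEq, true_and]
  constructor <;> split_ifs <;> rfl

theorem Decorated.not_win_root (h : Decorated N K x U f) : ¬ Win true U (K + 1) (x (K + 1)) := by
  cases f with
  | none => exact h.1 _ le_rfl
  | some v =>
    obtain ⟨m, u⟩ := v
    obtain ⟨h1, h2, -, h3⟩ := h
    simp only at h1 h2 h3
    subst h1
    have := h3 (K + 1) le_rfl (by omega)
    rwa [anc_run x (by omega)] at this

theorem unravel_bij {n : ℕ} (hn : n ≤ K) : Function.Bijective ((unravelHom N K).map n) := by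
  refine ⟨fun s t h => Subtype.ext ?_, fun p => ⟨⟨_, isDecorated_le hn p (fun _ _ => False) none⟩, rfl⟩⟩
  have h : s.1.1 = t.1.1 := h
  rw [← decode_eq_of_isDecorated s.2, ← decode_eq_of_isDecorated t.2, h]
  simp [decode, hn, show n ≤ K + 1 by omega]

theorem decode_of_le {n : ℕ} (hn : n ≤ K) (p : T.Pos n) (U V : Target T)
    (f g : Option (Σ m, T.Pos m)) : decode K n p U f = decode K n p V g := by
  simp [decode, hn, show n ≤ K + 1 by omega]

theorem eq_decode_succ {n : ℕ} {s : (unravel N K).Pos (n + 1)}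
    (hs : ((unravel N K).par s).1 = decode K n (x n) U f) (h1 : s.1.1 = x (n + 1))
    (h2 : n = K → s.1.2.1 = U) (h3 : n = K + 1 → s.1.2.2 = f) :
    s.1 = decode K (n + 1) (x (n + 1)) U f := by
  rw [← decode_eq_of_isDecorated s.2]
  simp only [unravel, decode, Prod.mk.injEq] at hs ⊢
  obtain ⟨-, hs1, hs2⟩ := hs
  refine ⟨h1, ?_, ?_⟩
  · by_cases hn : n + 1 ≤ K
    · simp [hn]
    · rw [if_neg hn, if_neg hn]
      by_cases hK : n = K
      · exact h2 hK
      · rwa [if_neg (by omega), if_neg (by omega)] at hs1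
  · by_cases hn : n + 1 ≤ K + 1
    · simp [hn]
    · rw [if_neg hn, if_neg hn]
      by_cases hK : n = K + 1
      · exact h3 hK
      · rwa [if_neg (by omega), if_neg (by omega)] at hs2

theorem snd_eq_of_par {n : ℕ} {s : (unravel N K).Pos (n + 1)} {p : T.Pos n}
    (hs : ((unravel N K).par s).1 = decode K n p U f) :
    T.par s.1.1 = p ∧ (K + 1 ≤ n → s.1.2.1 = U) ∧ (K + 2 ≤ n → s.1.2.2 = f) := by
  simp only [unravel, decode, Prod.mk.injEq] at hs
  obtain ⟨hs0, hs1, hs2⟩ := hs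
  refine ⟨hs0, fun h => ?_, fun h => ?_⟩
  · rwa [if_neg (by omega), if_neg (by omega)] at hs1
  · rwa [if_neg (by omega), if_neg (by omega)] at hs2

/-- A position of the unravelling at a late level is visible on a decorated run with its own
decorations. -/
theorem exists_decorated_of_pos {n : ℕ} (hn : K + 2 ≤ n) (s : (unravel N K).Pos n) :
    ∃ x : T.Run, x n = s.1.1 ∧ Decorated N K x s.1.2.1 s.1.2.2 := by
  obtain ⟨_, x, U, f, h, rfl⟩ := s
  refine ⟨x, rfl, ?_⟩
  simpa only [decode, if_neg (show ¬ n ≤ K by omega), if_neg (show ¬ n ≤ K + 1 by omega)] using h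

theorem Decorated.forced {m : ℕ} {u : T.Pos m} (h : Decorated N K x U (some ⟨m, u⟩)) {n : ℕ}
    (hn : n ≤ m) (hK : K + 2 ≤ n) {s : (unravel N K).Pos n}
    (hs : s.1.2.2 = some ⟨m, u⟩) : s.1.1 = x n := by
  obtain ⟨y, hy, hd⟩ := exists_decorated_of_pos hK s
  rw [hs] at hd
  rw [← hy]
  exact Run.eq_of_le hn (hd.1.trans h.1.symm)

open Classical in
/-- The strategy played on the original forest when decorations are fixed. -/
noncomputable def undecorate (σ : (unravel N K).Strat) (U : Target T)
    (f : Option (Σ m, T.Pos m)) : T.Strat := fun n p =>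
  if h : IsDecorated N K n (decode K n p U f) then
    ⟨(σ n ⟨_, h⟩).1.1.1, (snd_eq_of_par (congrArg Subtype.val (σ n ⟨_, h⟩).2)).1⟩
  else T.anyStrat n p

theorem undecorate_apply (σ : (unravel N K).Strat) {n : ℕ} {p : T.Pos n}
    (h : IsDecorated N K n (decode K n p U f)) :
    (undecorate σ U f n p).1 = (σ n ⟨_, h⟩).1.1.1 := by
  simp only [undecorate, dif_pos h]

/-- The set of positions announced by player `false` at level `K`. -/
noncomputable def announced (σ : (unravel N K).Strat) (r : T.Pos (K + 1)) : Target T :=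
  (σ K ⟨_, isDecorated_le le_rfl (T.par r) (fun _ _ => False) none⟩).1.1.2.1

/-- The positions which player `true` can answer at level `K + 1`, with the announcement `V`. -/
def Answers (σ : (unravel N K).Strat) (r : T.Pos (K + 1)) (m : ℕ) (u : T.Pos m)
    (V : Target T) : Prop :=
  ∃ h : ¬ Win true V (K + 1) r, (σ (K + 1) ⟨_, isDecorated_root h none⟩).1.1.2.2 = some ⟨m, u⟩

/-- The target of the combined strategy. -/
noncomputable def pushTarget : Bool → (unravel N K).Strat → T.Pos (K + 1) → Target T
  | false, σ, r => escape N K (announced σ r)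
  | true, σ, r => fun m u => ∃ V, Answers σ r m u V

/-- The announcement used before the target is met. -/
noncomputable def announceA : Bool → (unravel N K).Strat → T.Pos (K + 1) → Target T
  | false, σ, r => announced σ r
  | true, σ, r => pushTarget true σ r

/-- The announcement used after the target is met. -/
noncomputable def announceB : Bool → (unravel N K).Strat → T.Pos (K + 1) →
    ∀ m, T.Pos m → Target T
  | false, σ, r, _, _ => announced σ r
  | true, σ, r, m, u => Classical.epsilon (Answers σ r m u)

/-- The image of a strategy on the unravelling. -/
noncomputable def pushStrat (ρ : Bool) (σ : (unravel N K).Strat) : T.Strat := fun n p =>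
  if n ≤ K then undecorate σ (fun _ _ => False) none n p
  else combine ρ (K + 1) (pushTarget ρ σ (anc (K + 1) p))
    (fun m u => undecorate σ (announceB ρ σ (anc (K + 1) p) m u) (some ⟨m, u⟩))
    (undecorate σ (announceA ρ σ (anc (K + 1) p)) none) n p

theorem pushStrat_congr (ρ : Bool) (n : ℕ) (σ τ : (unravel N K).Strat)
    (h : ∀ m ≤ n, σ m = τ m) : pushStrat ρ σ n = pushStrat ρ τ n := by
  have hu : ∀ U f, undecorate σ U f n = undecorate τ U f n := fun U f => by
    funext p
    simp only [undecorate, h n le_rfl]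
  funext p
  simp only [pushStrat]
  split_ifs with hn
  · rw [hu]
  · have h0 : announced σ = announced τ := by
      funext r
      simp only [announced, h K (by omega)]
    have h1 : Answers σ = Answers τ := by
      funext r m u V
      simp only [Answers, h (K + 1) (by omega)]
    have h2 : pushTarget ρ σ = pushTarget ρ τ := by
      cases ρ <;> funext r <;> simp only [pushTarget, h0, h1]
    have h3 : announceA ρ σ = announceA ρ τ := by
      cases ρ <;> funext r
      · simp only [announceA, h0]
      · simp only [announceA, h2]
    have h4 : announceB ρ σ = announceB ρ τ := by
      cases ρ <;> funext r m u <;> simp only [announceB, h0, h1]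
    rw [h2, h3, h4]
    simp only [combine, hu]

theorem Decorated.follows_run {ρ : Bool} {σ : (unravel N K).Strat} (h : Decorated N K x U f)
    (hf : ∀ n, n.bodd = ρ → ((σ n (h.run n)).1.1.1 = x (n + 1)) ∧
      (n = K → (σ n (h.run n)).1.1.2.1 = U) ∧ (n = K + 1 → (σ n (h.run n)).1.1.2.2 = f)) :
    Follows ρ σ 0 h.run := fun n _ hn =>
  Subtype.ext (eq_decode_succ (congrArg Subtype.val (σ n (h.run n)).2) (hf n hn).1 (hf n hn).2.1
    (hf n hn).2.2).symm

theorem pushStrat_lift (hK : K.bodd = false) (ρ : Bool) (σ : (unravel N K).Strat) (x : T.Run)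
    (hx : Follows ρ (pushStrat ρ σ) 0 x) :
    ∃ y, Follows ρ σ 0 y ∧ (unravelHom N K).run y = x := by
  suffices H : ∃ (U : _) (f : _) (h : Decorated N K x U f), Follows ρ σ 0 h.run by
    obtain ⟨U, f, h, hf⟩ := H
    exact ⟨h.run, hf, rfl⟩
  have hlow : ∀ {U f} (h : Decorated N K x U f), ∀ n ≤ K, n.bodd = ρ →
      (σ n (h.run n)).1.1.1 = x (n + 1) := by
    intro U f h n hnK hn
    rw [hx n (Nat.zero_le n) hn]
    simp only [pushStrat, if_pos hnK]
    rw [undecorate_apply σ (isDecorated_le hnK _ _ _)]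
    have e : h.run n = ⟨_, isDecorated_le hnK (x n) (fun _ _ => False) none⟩ :=
      Subtype.ext (decode_of_le hnK (x n) _ _ _ _)
    rw [e]
  set r := x (K + 1) with hr
  have hfol : Follows ρ (combine ρ (K + 1) (pushTarget ρ σ r)
      (fun m u => undecorate σ (announceB ρ σ r m u) (some ⟨m, u⟩))
      (undecorate σ (announceA ρ σ r) none)) (K + 1) x := by
    intro j hj hjρ
    rw [hx j (Nat.zero_le j) hjρ]
    simp only [pushStrat, if_neg (show ¬ j ≤ K by omega), anc_run x hj, ← hr]
  have happ : ∀ {U f} (h : Decorated N K x U f) n,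
      (undecorate σ U f n (x n)).1 = (σ n (h.run n)).1.1.1 := fun h n =>
    undecorate_apply σ ⟨x, _, _, h, rfl⟩
  have hann : ∀ {U f} (h : Decorated N K x U f), announced σ r = (σ K (h.run K)).1.1.2.1 := by
    intro U f h
    have e : h.run K = ⟨_, isDecorated_le le_rfl (T.par r) (fun _ _ => False) none⟩ := by
      refine Subtype.ext ((decode_of_le le_rfl (x K) U (fun _ _ => False) f none).trans ?_)
      rw [hr, x.par_eq]
    rw [e]
    rfl
  have hKρ : ∀ {n}, n.bodd = true → n ≠ K := by
    rintro n hn rfl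
    simp [hn] at hK
  have hKρ' : ∀ {n}, n.bodd = false → n ≠ K + 1 := by
    rintro n hn rfl
    simp [hK] at hn
  cases ρ with
  | false =>
    have hroot : ¬ Win true (announced σ r) (K + 1) r := by
      set s := σ K ⟨_, isDecorated_le le_rfl (T.par r) (fun _ _ => False) none⟩ with hs
      have hs1 : s.1.1.1 = r := by
        have := hx K (Nat.zero_le K) hK
        simp only [pushStrat, if_pos le_rfl] at this
        rw [← x.par_eq K, ← hr, undecorate_apply σ (isDecorated_le le_rfl _ _ _)] at this
        exact this.symm
      obtain ⟨y, V, f, hd, he⟩ := s.1.2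
      have h1 : y (K + 1) = r := by
        rw [← hs1, ← he]
        rfl
      have h2 : V = announced σ r := by
        simp only [announced]
        rw [← hs, ← he]
        simp [decode]
      rw [← h2, ← h1]
      exact hd.not_win_root
    rcases combine_spec hfol with ⟨hw, hA⟩ | ⟨m, hm, hB⟩
    · simp only [pushTarget, announceA] at hw hA
      have hd : Decorated N K x (announced σ r) none := by
        refine ⟨fun j hj => ?_, fun j hj => hw j (by omega)⟩
        induction j using Nat.strong_induction_on with
        | _ j ih =>
        rcases Nat.lt_or_ge (K + 1) j with hlt | hle
        · obtain ⟨j, rfl⟩ : ∃ i, j = i + 1 := ⟨j - 1, by omega⟩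
          cases hjb : j.bodd with
          | true => exact fun h => ih j (by omega) (by omega) (h.of_child hjb (x.par_eq j))
          | false =>
            have hne := hKρ' hjb
            have hdec : IsDecorated N K j (decode K j (x j) (announced σ r) none) :=
              isDecorated_none (by omega) (fun i hi hij => ih i (by omega) hi)
                fun i hi _ => hw i (by omega)
            have h1 := hA j (by omega) hjb
            rw [undecorate_apply σ hdec] at h1
            obtain ⟨-, h2, h3⟩ := snd_eq_of_par (congrArg Subtype.val (σ j ⟨_, hdec⟩).2)
            obtain ⟨y, hy, hyd⟩ := exists_decorated_of_pos (by omega) (σ j ⟨_, hdec⟩).1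
            rw [h2 (by omega), h3 (by omega)] at hyd
            rw [h1, ← hy]
            exact hyd.1 _ (by omega)
        · obtain rfl : j = K + 1 := by omega
          exact hroot
      refine ⟨_, none, hd, hd.follows_run fun n hn => ⟨?_, ?_, fun h => (hKρ' hn h).elim⟩⟩
      · rcases Nat.lt_or_ge K n with h | h
        · rw [hA n h hn, happ hd]
        · exact hlow hd n h hn
      · rintro rfl
        exact (hann hd).symm
    · simp only [pushTarget, announceB] at hm hB
      have hd : Decorated N K x (announced σ r) (some ⟨m, x m⟩) := ⟨rfl, hm⟩
      refine ⟨_, _, hd, hd.follows_run fun n hn => ⟨?_, ?_, fun h => (hKρ' hn h).elim⟩⟩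
      · rcases Nat.lt_or_ge K n with h | h
        · rcases Nat.lt_or_ge n m with hnm | hnm
          · have hne := hKρ' hn
            refine hd.forced (by omega) (by omega) ?_
            exact (snd_eq_of_par (congrArg Subtype.val (σ n (hd.run n)).2)).2.2 (by omega)
          · rw [hB n h hnm hn, happ hd]
        · exact hlow hd n h hn
      · rintro rfl
        exact (hann hd).symm
  | true =>
    rcases combine_spec hfol with ⟨hw, hA⟩ | ⟨m, hm, hB⟩
    · simp only [announceA] at hA
      set V := pushTarget true σ r with hV
      have hroot : ¬ Win true V (K + 1) r := hw (K + 1) le_rfl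
      set s := σ (K + 1) ⟨_, isDecorated_root hroot none⟩ with hs
      obtain ⟨-, hs1, -⟩ := snd_eq_of_par (congrArg Subtype.val s.2)
      obtain ⟨y, hy, hyd⟩ := exists_decorated_of_pos le_rfl s.1
      have hs2 : s.1.1.1 = x (K + 2) := by
        rw [hA (K + 1) le_rfl (by simp [hK]), undecorate_apply σ (isDecorated_root hroot none)]
      have hs3 : s.1.1.2.2 = none := by
        by_contra hne
        obtain ⟨⟨m, u⟩, hmu⟩ := Option.ne_none_iff_exists'.1 hne
        rw [hs1 le_rfl, hmu] at hyd
        obtain ⟨h1, h2, -, h3⟩ := hyd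
        simp only at h1 h2 h3
        have h4 := h3 m (by omega) le_rfl
        rw [← h1, anc_run y le_rfl, h1] at h4
        exact h4 (Win.of_target ⟨V, hroot, hmu⟩)
      rw [hs1 le_rfl, hs3] at hyd
      have hd : Decorated N K x V none := by
        refine ⟨hw, fun j hj => ?_⟩
        induction j using Nat.strong_induction_on with
        | _ j ih =>
        rcases Nat.lt_or_ge (K + 2) j with hlt | hle
        · obtain ⟨j, rfl⟩ : ∃ i, j = i + 1 := ⟨j - 1, by omega⟩
          cases hjb : j.bodd with
          | false => exact fun h => ih j (by omega) (by omega) (h.of_child hjb (x.par_eq j))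
          | true =>
            have hdec : IsDecorated N K j (decode K j (x j) V none) :=
              isDecorated_none (by omega) (fun i hi _ => hw i hi)
                fun i hi hij => ih i (by omega) hi
            have h1 := hA j (by omega) hjb
            rw [undecorate_apply σ hdec] at h1
            obtain ⟨-, h2, h3⟩ := snd_eq_of_par (congrArg Subtype.val (σ j ⟨_, hdec⟩).2)
            obtain ⟨y, hy, hyd⟩ := exists_decorated_of_pos (by omega) (σ j ⟨_, hdec⟩).1
            rw [h2 (by omega), h3 (by omega)] at hyd
            rw [h1, ← hy]
            exact hyd.2 _ (by omega)
        · obtain rfl : j = K + 2 := by omega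
          rw [← hs2, ← hy]
          exact hyd.2 _ le_rfl
      refine ⟨_, none, hd, hd.follows_run fun n hn =>
        ⟨?_, fun h => (hKρ hn h).elim, ?_⟩⟩
      · rcases Nat.lt_or_ge K n with h | h
        · rw [hA n h hn, happ hd]
        · exact hlow hd n h hn
      · rintro rfl
        exact hs3
    · simp only [announceB] at hB
      obtain ⟨hroot, hsf⟩ : Answers σ r m (x m) (Classical.epsilon (Answers σ r m (x m))) :=
        Classical.epsilon_spec hm
      set V := Classical.epsilon (Answers σ r m (x m)) with hV
      set s := σ (K + 1) ⟨_, isDecorated_root hroot none⟩ with hs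
      obtain ⟨-, hs1, -⟩ := snd_eq_of_par (congrArg Subtype.val s.2)
      obtain ⟨y, hy, hyd⟩ := exists_decorated_of_pos le_rfl s.1
      rw [hs1 le_rfl, hsf] at hyd
      have hd : Decorated N K x V (some ⟨m, x m⟩) := ⟨rfl, hyd.2⟩
      have hpos : hd.run (K + 1) = ⟨_, isDecorated_root hroot none⟩ :=
        Subtype.ext (by simp [Decorated.run, decode, ← hr])
      refine ⟨_, _, hd, hd.follows_run fun n hn =>
        ⟨?_, fun h => (hKρ hn h).elim, ?_⟩⟩
      · rcases Nat.lt_or_ge K n with h | h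
        · rcases Nat.lt_or_ge n m with hnm | hnm
          · refine hd.forced (by omega) (by omega) ?_
            rcases Nat.lt_or_ge (K + 1) n with h | h
            · exact (snd_eq_of_par (congrArg Subtype.val (σ n (hd.run n)).2)).2.2 (by omega)
            · obtain rfl : n = K + 1 := by omega
              rw [hpos]
              exact hsf
          · rw [hB n h hnm hn, happ hd]
        · exact hlow hd n h hn
      · rintro rfl
        rw [hpos]
        exact hsf

/-- The unravelling covers the original forest. -/
noncomputable def unravelCover (hK : K.bodd = false) : Cover K (unravel N K) T where
  toHom := unravelHom N K
  bij n hn := unravel_bij hn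
  strat := pushStrat
  strat_congr := pushStrat_congr
  strat_map ρ σ n hn p := by
    have h := isDecorated_le (N := N) hn.le p.1.1 (fun _ _ => False) none
    have hp : p = ⟨_, h⟩ := (unravel_bij hn.le).1 rfl
    simp only [pushStrat, if_pos hn.le]
    refine (undecorate_apply σ h).trans ?_
    rw [← hp]
    rfl
  lift := pushStrat_lift hK

theorem unravel_snd (x : (unravel N K).Run) {j : ℕ} (hj : K + 2 ≤ j) :
    (x j).1.2.2 = (x (K + 2)).1.2.2 := by
  induction j, hj using Nat.le_induction with
  | base => rfl
  | succ j hj ih =>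
    have hp : ((unravel N K).par (x (j + 1))).1 = _ :=
      (congrArg Subtype.val (x.par_eq j)).trans (decode_eq_of_isDecorated (x j).2).symm
    rw [(snd_eq_of_par hp).2.2 hj, ih]

theorem unravel_none {x : (unravel N K).Run} (hN : ∀ n q, N n (T.par q) → N (n + 1) q)
    (h : (x (K + 2)).1.2.2 = none) (n : ℕ) : ¬ N n ((unravelHom N K).run x n) := by
  have hN' : ∀ (y : T.Run) m n, m ≤ n → N m (y m) → N n (y n) := fun y m n hmn hm => by
    induction n, hmn using Nat.le_induction with
    | base => exact hm
    | succ n _ ih => exact hN n _ (by rwa [y.par_eq])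
  intro hn
  have hm := hN' _ n (n + (K + 2)) (by omega) hn
  set m := n + (K + 2) with hmdef
  obtain ⟨y, hy, hd⟩ := exists_decorated_of_pos (by omega) (x m)
  rw [unravel_snd x (by omega), h] at hd
  refine hd.2 m (by omega) (Win.of_target ⟨by omega, ?_, fun j hj hjm => ?_⟩)
  · rw [hy]
    exact hm
  · rw [anc_run y hjm]
    exact hd.1 j hj

theorem unravel_some {x : (unravel N K).Run} {v} (h : (x (K + 2)).1.2.2 = some v) :
    N v.1 ((unravelHom N K).run x v.1) := by
  obtain ⟨y, hy, hd⟩ := exists_decorated_of_pos (show K + 2 ≤ v.1 + (K + 2) by omega)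
    (x (v.1 + (K + 2)))
  rw [unravel_snd x (by omega), h] at hd
  have hxy : (unravelHom N K).run x v.1 = y v.1 := Run.eq_of_le (Nat.le_add_right _ (K + 2)) hy.symm
  rw [hxy, hd.1]
  exact hd.2.2.1

end Unravel

end GameForest

namespace GameForest

/-- Open sets of runs. -/
def OpenRun {T : GameForest} (X : Set T.Run) : Prop :=
  ∀ x ∈ X, ∃ n, ∀ y : T.Run, y n = x n → y ∈ X

/-- Clopen sets of runs. -/
def ClopenRun {T : GameForest} (X : Set T.Run) : Prop := OpenRun X ∧ OpenRun Xᶜ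

theorem OpenRun.preimage {T' T : GameForest} {X : Set T.Run} (h : OpenRun X) (f : Hom T' T) :
    OpenRun (f.run ⁻¹' X) := fun x hx => by
  obtain ⟨n, hn⟩ := h _ hx
  exact ⟨n, fun y hy => hn _ (congrArg (f.map n) hy)⟩

theorem ClopenRun.preimage {T' T : GameForest} {X : Set T.Run} (h : ClopenRun X)
    (f : Hom T' T) : ClopenRun (f.run ⁻¹' X) := ⟨h.1.preimage f, h.2.preimage f⟩

/-- The positions all of whose runs are in `X`. -/
def Decided {T : GameForest} (X : Set T.Run) (n : ℕ) (p : T.Pos n) : Prop :=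
  ∀ y : T.Run, y n = p → y ∈ X

theorem OpenRun.mem_iff {T : GameForest} {X : Set T.Run} (h : OpenRun X) {x : T.Run} :
    x ∈ X ↔ ∃ n, Decided X n (x n) := ⟨h x, fun ⟨_, hn⟩ => hn x rfl⟩

theorem OpenRun.exists_cover {T : GameForest} {X : Set T.Run} (h : OpenRun X) {K : ℕ}
    (hK : K.bodd = false) :
    ∃ (T' : GameForest) (c : Cover K T' T), ClopenRun (c.run ⁻¹' X) := by
  refine ⟨unravel (Decided X) K, unravelCover hK, ?_⟩
  have hN : ∀ n q, Decided X n (T.par q) → Decided X (n + 1) q := fun n q hq y hy =>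
    hq y (by rw [← y.par_eq, hy])
  have key : ∀ x : (unravel (Decided X) K).Run,
      (unravelHom (Decided X) K).run x ∈ X ↔ (x (K + 2)).1.2.2 ≠ none := by
    intro x
    rw [h.mem_iff]
    constructor
    · rintro ⟨n, hn⟩ hx
      exact unravel_none hN hx n hn
    · intro hx
      obtain ⟨v, hv⟩ := Option.ne_none_iff_exists'.1 hx
      exact ⟨v.1, unravel_some hv⟩
  constructor
  · intro x hx
    refine ⟨K + 2, fun y hy => (key y).2 ?_⟩
    rw [hy]
    exact (key x).1 hx
  · intro x hx
    refine ⟨K + 2, fun y hy hy' => hx ((key x).2 ?_)⟩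
    rw [← hy]
    exact (key y).1 hy'

/-- Sets of runs which can be made clopen by coverings, hereditarily. -/
def Unravelable (T : GameForest) (X : Set T.Run) : Prop :=
  ∀ (T' : GameForest) (f : Hom T' T) (K : ℕ), K.bodd = false →
    ∃ (T'' : GameForest) (c : Cover K T'' T'), ClopenRun ((f.comp c.toHom).run ⁻¹' X)

variable {T : GameForest}

theorem ClopenRun.unravelable {X : Set T.Run} (h : ClopenRun X) : Unravelable T X :=
  fun T' f K _ => ⟨T', Cover.id K T', h.preimage (f.comp (Cover.id K T').toHom)⟩

theorem Unravelable.compl {X : Set T.Run} (h : Unravelable T X) : Unravelable T Xᶜ :=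
  fun T' f K hK => by
    obtain ⟨T'', c, h1, h2⟩ := h T' f K hK
    exact ⟨T'', c, h2, by rwa [Set.preimage_compl, compl_compl]⟩

theorem Unravelable.iUnion {X : ℕ → Set T.Run} (h : ∀ i, Unravelable T (X i)) :
    Unravelable T (⋃ i, X i) := by
  intro T' f K hK
  have hk : ∀ i, (K + 2 * i + 2).bodd = false := fun i => by simp [hK]
  choose E c hc using fun i (S : Σ S : GameForest, Hom S T) =>
    h i S.1 S.2 (K + 2 * i + 2) (hk i)
  let S : ℕ → Σ S : GameForest, Hom S T := fun i =>
    Nat.rec ⟨T', f⟩ (fun i s => ⟨E i s, s.2.comp (c i s).toHom⟩) i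
  let d : ∀ i, Cover (K + 2 * i + 2) (S (i + 1)).1 (S i).1 := fun i => c i (S i)
  have hmono : Monotone fun i => K + 2 * i + 2 := fun i j hij => by simp only; omega
  have hlt : ∀ i, i < K + 2 * i + 2 := fun i => by omega
  let P := limitProj (T := fun i => (S i).1) d hmono hlt
  have hP : ∀ i x, (S i).2.run ((P i).run x) = f.run ((P 0).run x) := by
    intro i x
    induction i with
    | zero => rfl
    | succ i ih =>
      rw [← ih]
      have : (d i).run ((P (i + 1)).run x) = (P i).run x := Run.ext fun n => (x n).2 i
      rw [← this]
      rfl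
  have hopen : OpenRun ((f.comp (P 0)).run ⁻¹' ⋃ i, X i) := by
    intro x hx
    obtain ⟨i, hi⟩ := Set.mem_iUnion.1 hx
    have hcl := ((hc i (S i)).preimage (P (i + 1))).1
    have hmem : ∀ y, y ∈ (P (i + 1)).run ⁻¹' (((S i).2.comp (c i (S i)).toHom).run ⁻¹' X i) ↔
        (f.comp (P 0)).run y ∈ X i := fun y => by
      rw [Set.mem_preimage, Set.mem_preimage]
      have := hP (i + 1) y
      change (S (i + 1)).2.run _ ∈ _ ↔ f.run ((P 0).run y) ∈ _
      rw [this]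
    obtain ⟨n, hn⟩ := hcl x ((hmem x).2 hi)
    exact ⟨n, fun y hy => Set.mem_iUnion.2 ⟨i, (hmem y).1 (hn y hy)⟩⟩
  obtain ⟨T'', e, he⟩ := hopen.exists_cover hK
  exact ⟨T'', (limitCover (T := fun i => (S i).1) (c := d) (hk := hmono) (hlt := hlt) (by simp)).comp e, he⟩

theorem OpenRun.determined {X : Set T.Run} (h : OpenRun X) (r : T.Pos 0) :
    ∃ (ρ : Bool) (σ : T.Strat), ∀ x : T.Run, x 0 = r → Follows ρ σ 0 x → (x ∈ X ↔ ρ = false) := by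
  classical
  by_cases hw : Win false (Decided X) 0 r
  · obtain ⟨σ, hσ⟩ := hw
    refine ⟨false, σ, fun x hx hf => iff_of_true ?_ rfl⟩
    obtain ⟨j, -, hj⟩ := hσ x hx hf
    exact hj x rfl
  · let σ : T.Strat := fun n p => if h : ¬ Win false (Decided X) n p then
      ⟨(Win.exists_child h).choose, (Win.exists_child h).choose_spec.1⟩ else T.anyStrat n p
    refine ⟨true, σ, fun x hx hf => iff_of_false (fun hX => ?_) (by simp)⟩
    have hn : ∀ n, ¬ Win false (Decided X) n (x n) := fun n => by
      induction n with
      | zero => rwa [hx]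
      | succ n ih =>
        cases hb : n.bodd with
        | false => exact fun h => ih (h.of_child hb (x.par_eq n))
        | true =>
          rw [hf n (Nat.zero_le n) hb]
          simp only [σ, dif_pos ih]
          exact (Win.exists_child ih).choose_spec.2
    obtain ⟨n, h⟩ := h.mem_iff.1 hX
    exact hn n (Win.of_target h)

theorem Unravelable.determined {X : Set T.Run} (h : Unravelable T X) (r : T.Pos 0) :
    ∃ (ρ : Bool) (σ : T.Strat), ∀ x : T.Run, x 0 = r → Follows ρ σ 0 x → (x ∈ X ↔ ρ = false) := by
  obtain ⟨T', c, hc⟩ := h T (Hom.id T) 0 rfl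
  obtain ⟨r', rfl⟩ := (c.bij 0 le_rfl).2 r
  obtain ⟨ρ, σ, hσ⟩ := hc.1.determined r'
  refine ⟨ρ, c.strat ρ σ, fun x hx hf => ?_⟩
  obtain ⟨y, hy, rfl⟩ := c.lift ρ σ x hf
  exact hσ y ((c.bij 0 le_rfl).1 hx) hy

section Product

variable {G : Type} (lev : G → ℕ)

/-- The game in which the coordinates of a point of `G → ℕ` are played in the order given by
their level. -/
def product : GameForest where
  Pos n := {g // lev g ≤ n} → ℕ
  par p g := p ⟨g.1, g.2.trans (Nat.le_succ _)⟩
  par_surj n p := ⟨fun g => if h : lev g.1 ≤ n then p ⟨g.1, h⟩ else 0, by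
    funext g
    simp [g.2]⟩

variable {lev}

/-- The point of `G → ℕ` constructed by a run. -/
def outcome (x : (product lev).Run) (g : G) : ℕ := x (lev g) ⟨g, le_rfl⟩

variable (lev) in
/-- The run constructing a point of `G → ℕ`. -/
def runOf (y : G → ℕ) : (product lev).Run where
  pos _ g := y g.1
  par_eq _ := rfl

theorem unravelable_outcome {W : Set (G → ℕ)} (hW : MeasurableSet W) :
    Unravelable (product lev) (outcome ⁻¹' W) := by
  let m : MeasurableSpace (G → ℕ) :=
    { MeasurableSet' := fun W => Unravelable (product lev) (outcome ⁻¹' W)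
      measurableSet_empty := ClopenRun.unravelable
        ⟨fun x hx => hx.elim, fun x _ => ⟨0, fun y _ hy => hy⟩⟩
      measurableSet_compl := fun W hW => hW.compl
      measurableSet_iUnion := fun W hW => by
        rw [Set.preimage_iUnion]
        exact Unravelable.iUnion hW }
  suffices h : (MeasurableSpace.pi : MeasurableSpace (G → ℕ)) ≤ m from h W hW
  refine iSup_le fun g => ?_
  rintro _ ⟨S, -, rfl⟩
  refine ClopenRun.unravelable ⟨fun x hx => ⟨lev g, fun y hy => ?_⟩,
    fun x hx => ⟨lev g, fun y hy => ?_⟩⟩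
  · have : outcome y g = outcome x g := congrFun hy _
    simpa [this] using hx
  · have : outcome y g = outcome x g := congrFun hy _
    simpa [this] using hx

/-- Borel determinacy for the game of playing the coordinates of a point of `G → ℕ` by
levels. -/
theorem exists_winning (lev : G → ℕ) {D : Set (G → ℕ)} (hD : MeasurableSet D) (r : G → ℕ) :
    ∃ (ρ : Bool) (s : G → (G → ℕ) → ℕ),
      (∀ g y y', (∀ h, lev h < lev g → y h = y' h) → s g y = s g y') ∧
      ∀ y, (∀ h, lev h = 0 → y h = r h) →
        (∀ g j, lev g = j + 1 → j.bodd = ρ → y g = s g y) → (y ∈ D ↔ ρ = true) := by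
  obtain ⟨ρ, σ, hσ⟩ := (unravelable_outcome (lev := lev) hD.compl).determined fun g => r g.1
  let s : G → (G → ℕ) → ℕ := fun g y => if h : 0 < lev g then
    (σ (lev g - 1) (runOf lev y (lev g - 1))).1 ⟨g, by omega⟩ else 0
  refine ⟨ρ, s, fun g y y' h => ?_, fun y hr hy => ?_⟩
  · by_cases h0 : 0 < lev g
    · have hyy' : runOf lev y (lev g - 1) = runOf lev y' (lev g - 1) :=
        funext fun k => h k.1 (by have := k.2; omega)
      simp only [s, dif_pos h0]
      rw [hyy']
    · simp only [s, dif_neg h0]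
  · have h1 := hσ (runOf lev y) (funext fun g => hr g.1 (Nat.le_zero.1 g.2)) fun j _ hj => ?_
    · have h2 : outcome (runOf lev y) = y := rfl
      cases ρ <;> simpa [h2] using h1
    · funext ⟨g, hg⟩
      rcases Nat.lt_or_ge j (lev g) with h | h
      · have hg' : lev g = j + 1 := le_antisymm hg h
        have := hy g j hg' hj
        obtain rfl : j = lev g - 1 := by omega
        simp only [s, dif_pos (show 0 < lev g by omega)] at this
        exact this
      · exact (congrFun (σ j (runOf lev y j)).2 ⟨g, h⟩).symm

end Product

end GameForest

section Recursion

variable {G : Type} {rk : G → ℕ} {S : G → (G → ℕ) → ℕ}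

theorem exists_fixed_of_rank
    (hS : ∀ g y y', (∀ h, rk h < rk g → y h = y' h) → S g y = S g y') :
    ∃ y : G → ℕ, ∀ g, y g = S g y := by
  let Y : ℕ → G → ℕ := fun m => Nat.rec (fun _ => 0) (fun _ y g => S g y) m
  have hY : ∀ m m' g, rk g < m → rk g < m' → Y m g = Y m' g := by
    intro m
    induction m with
    | zero => intro _ _ h; omega
    | succ m ih =>
      intro m' g h h'
      obtain ⟨m', rfl⟩ : ∃ j, m' = j + 1 := ⟨m' - 1, by omega⟩
      exact hS g _ _ fun h _ => ih m' h (by omega) (by omega)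
  refine ⟨fun g => Y (rk g + 1) g, fun g => hS g _ _ fun h hh => ?_⟩
  exact hY _ _ h hh (Nat.lt_succ_self _)

theorem fixed_unique_of_rank
    (hS : ∀ g y y', (∀ h, rk h < rk g → y h = y' h) → S g y = S g y') {y y' : G → ℕ}
    (hy : ∀ g, y g = S g y) (hy' : ∀ g, y' g = S g y') : y = y' := by
  have : ∀ m g, rk g < m → y g = y' g := by
    intro m
    induction m with
    | zero => intro _ h; omega
    | succ m ih =>
      intro g h
      rw [hy, hy']
      exact hS g _ _ fun h _ => ih h (by omega)
  exact funext fun g => this _ g (Nat.lt_succ_self _)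

end Recursion

namespace FreeGroup

variable {α : Type} [DecidableEq α]

/-- The reduced word of `g` starts with a power of the generator `i`. -/
def HeadIs (i : α) (g : FreeGroup α) : Prop := ∃ b L, g.toWord = (i, b) :: L

theorem not_headIs_one (i : α) : ¬ HeadIs i (1 : FreeGroup α) := by
  rintro ⟨b, L, h⟩
  simp at h

theorem exists_headIs {g : FreeGroup α} (hg : g ≠ 1) : ∃ i, HeadIs i g := by
  cases h : g.toWord with
  | nil => exact (hg (toWord_eq_nil_iff.1 h)).elim
  | cons a L => exact ⟨a.1, a.2, L, h⟩

theorem HeadIs.eq {i j : α} {g : FreeGroup α} (hi : HeadIs i g) (hj : HeadIs j g) : i = j := by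
  obtain ⟨b, L, h⟩ := hi
  obtain ⟨b', L', h'⟩ := hj
  rw [h] at h'
  simp_all

theorem mk_replicate (i : α) (m : ℤ) :
    mk (List.replicate m.natAbs (i, decide (0 ≤ m))) = of i ^ m := by
  have h1 : ∀ k : ℕ, mk (List.replicate k (i, true)) = of i ^ k := fun k => by
    rw [← toWord_of_pow, mk_toWord]
  rcases Int.natAbs_eq m with h | h
  · have h0 : 0 ≤ m := by omega
    simp only [h0, decide_true, h1]
    conv_rhs => rw [h, zpow_natCast]
  · by_cases h0 : 0 ≤ m
    · obtain rfl : m = 0 := by omega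
      simp [one_eq_mk]
    · simp only [h0, decide_false]
      conv_rhs => rw [h, zpow_neg, zpow_natCast, ← h1, inv_mk]
      simp [invRev]

theorem toWord_zpow_mul {i : α} {g : FreeGroup α} (hg : ¬ HeadIs i g) (m : ℤ) :
    (of i ^ m * g).toWord = List.replicate m.natAbs (i, decide (0 ≤ m)) ++ g.toWord := by
  have hred : ∀ (k : ℕ) (b : Bool), IsReduced (List.replicate k (i, b) ++ g.toWord) := by
    intro k b
    induction k with
    | zero => simpa using isReduced_toWord
    | succ k ih =>
      rw [List.replicate_succ, List.cons_append, IsReduced, List.isChain_cons]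
      refine ⟨fun c hc => ?_, ih⟩
      cases k with
      | zero =>
        rintro rfl
        refine (hg ?_).elim
        cases hw : g.toWord with
        | nil => simp [hw] at hc
        | cons a L =>
          refine ⟨a.2, L, ?_⟩
          simp only [List.replicate_zero, List.nil_append, hw, List.head?_cons,
            Option.mem_some_iff] at hc
          simp [hw, hc]
      | succ k =>
        simp only [List.replicate_succ, List.cons_append, List.head?_cons,
          Option.mem_some_iff] at hc
        simp [← hc]
  rw [← mk_replicate, ← (hred _ _).reduce_eq, ← toWord_mk, ← mul_mk, mk_toWord]

theorem exists_zpow_mul (i : α) (g : FreeGroup α) :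
    ∃ (m : ℤ) (h : FreeGroup α), ¬ HeadIs i h ∧ g = of i ^ m * h := by
  induction hk : g.norm using Nat.strong_induction_on generalizing g with
  | _ k ih =>
  by_cases hg : HeadIs i g
  · obtain ⟨b, L, hL⟩ := hg
    have h1 : g = mk [(i, b)] * mk L := by
      rw [mul_mk, ← mk_toWord (x := g), hL]
      rfl
    have h2 : (mk L).norm < k := by
      have : g.norm = L.length + 1 := by simp [norm, hL]
      have := norm_mk_le (L₁ := L)
      omega
    obtain ⟨m, h, hh, he⟩ := ih _ h2 _ rfl
    obtain ⟨ε, hε⟩ : ∃ ε : ℤ, mk [(i, b)] = of i ^ ε := by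
      cases b with
      | true => exact ⟨1, by rw [zpow_one]; rfl⟩
      | false => exact ⟨-1, by rw [zpow_neg_one]; rfl⟩
    exact ⟨ε + m, h, hh, by rw [h1, he, hε, zpow_add, mul_assoc]⟩
  · exact ⟨0, g, hg, by simp⟩

theorem zpow_mul_inj {i : α} {g h : FreeGroup α} (hg : ¬ HeadIs i g) (hh : ¬ HeadIs i h)
    {m k : ℤ} (e : of i ^ m * g = of i ^ k * h) : m = k ∧ g = h := by
  have h1 : h = of i ^ (m - k) * g := by
    rw [sub_eq_neg_add, zpow_add, mul_assoc, e, zpow_neg, inv_mul_cancel_left]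
  have h2 : m - k = 0 := by
    by_contra h0
    refine hh ?_
    rw [h1, HeadIs, toWord_zpow_mul hg]
    obtain ⟨r, hr⟩ : ∃ r, (m - k).natAbs = r + 1 := ⟨(m - k).natAbs - 1, by omega⟩
    rw [hr, List.replicate_succ]
    exact ⟨_, _, rfl⟩
  rw [h2] at h1
  exact ⟨by omega, by simpa using h1.symm⟩

/-- The exponent of the maximal initial power of the generator `i` in `g`. -/
noncomputable def lead (i : α) (g : FreeGroup α) : ℤ := (exists_zpow_mul i g).choose

/-- The part of `g` after the maximal initial power of the generator `i`. -/
noncomputable def rest (i : α) (g : FreeGroup α) : FreeGroup α :=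
  (exists_zpow_mul i g).choose_spec.choose

theorem not_headIs_rest (i : α) (g : FreeGroup α) : ¬ HeadIs i (rest i g) :=
  (exists_zpow_mul i g).choose_spec.choose_spec.1

theorem lead_mul_rest (i : α) (g : FreeGroup α) : of i ^ lead i g * rest i g = g :=
  (exists_zpow_mul i g).choose_spec.choose_spec.2.symm

theorem lead_rest_zpow_mul (i : α) (m : ℤ) (g : FreeGroup α) :
    lead i (of i ^ m * g) = m + lead i g ∧ rest i (of i ^ m * g) = rest i g := by
  refine zpow_mul_inj (not_headIs_rest i _) (not_headIs_rest i g) ?_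
  rw [lead_mul_rest, zpow_add, mul_assoc, lead_mul_rest]

theorem rest_of_not_headIs {i : α} {g : FreeGroup α} (hg : ¬ HeadIs i g) :
    lead i g = 0 ∧ rest i g = g :=
  zpow_mul_inj (not_headIs_rest i _) hg (by rw [lead_mul_rest, zpow_zero, one_mul])

theorem norm_rest_lt {i : α} {g : FreeGroup α} (hg : HeadIs i g) :
    (rest i g).norm < g.norm := by
  have h1 := congrArg List.length (toWord_zpow_mul (not_headIs_rest i g) (lead i g))
  rw [lead_mul_rest, List.length_append, List.length_replicate] at h1
  have h2 : lead i g ≠ 0 := fun h0 => by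
    refine not_headIs_rest i g ?_
    have := lead_mul_rest i g
    rw [h0, zpow_zero, one_mul] at this
    rwa [this]
  simp only [norm]
  omega

open Classical in
/-- The order in which coordinates are played: player `false` plays the coordinates starting with
the generator `i`. -/
noncomputable def turn (i : α) (g : FreeGroup α) : ℕ :=
  if HeadIs i g then 2 * g.norm - 1 else 2 * g.norm

theorem norm_pos {g : FreeGroup α} (hg : g ≠ 1) : 0 < g.norm :=
  Nat.pos_of_ne_zero fun h => hg (norm_eq_zero.1 h)

theorem HeadIs.ne_one {i : α} {g : FreeGroup α} (h : HeadIs i g) : g ≠ 1 := by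
  rintro rfl
  exact not_headIs_one i h

theorem turn_eq_zero {i : α} {g : FreeGroup α} (h : turn i g = 0) : g = 1 := by
  by_contra hg
  have := norm_pos hg
  simp only [turn] at h
  split_ifs at h <;> omega

theorem headIs_of_turn {i : α} {g : FreeGroup α} {j : ℕ} (h : turn i g = j + 1) :
    HeadIs i g ↔ j.bodd = false := by
  rw [turn] at h
  split_ifs at h with hi
  · have := norm_pos hi.ne_one
    obtain ⟨k, hk⟩ : ∃ k, g.norm = k + 1 := ⟨g.norm - 1, by omega⟩
    obtain rfl : j = 2 * k := by omega
    simp [hi]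
  · obtain ⟨k, hk⟩ : ∃ k, g.norm = k + 1 := ⟨g.norm - 1, by omega⟩
    obtain rfl : j = 2 * k + 1 := by omega
    simp [hi]

theorem norm_rest_lt_of_turn {i : α} {g h : FreeGroup α} (hg : ¬ HeadIs i g)
    (hh : turn i h < turn i g) : (rest i h).norm < g.norm := by
  simp only [turn, if_neg hg] at hh
  split_ifs at hh with hi
  · have := norm_rest_lt hi
    omega
  · rw [(rest_of_not_headIs hi).2]
    omega

theorem norm_lt_of_turn {i : α} {g h : FreeGroup α} (hg : HeadIs i g)
    (hh : turn i h < turn i g) : h.norm < g.norm := by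
  simp only [turn, if_pos hg] at hh
  split_ifs at hh with hi <;> omega

theorem finite_norm_lt [Finite α] (k : ℕ) : {g : FreeGroup α | g.norm < k}.Finite :=
  Set.Finite.of_finite_image ((List.finite_length_lt (α × Bool) k).subset
    (by rintro _ ⟨g, hg, rfl⟩; exact hg)) toWord_injective.injOn

end FreeGroup

open FreeGroup in
/-- If finitely many Borel sets cover `F → ℕ`, one of them contains all the shifts along a line of
a point whose values on this line are prescribed. -/
theorem exists_line_map {α : Type} [DecidableEq α] [Finite α]
    {D : α → Set (FreeGroup α → ℕ)} (hD : ∀ i, MeasurableSet (D i)) (hcov : ∀ y, ∃ i, y ∈ D i) :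
    ∃ (i : α) (e : ℕ → ℕ) (f : (ℤ → ℕ) → FreeGroup α → ℕ), e.Injective ∧ Continuous f ∧
      (∀ x m, f (fun k => x (k + m)) = shift (of i ^ (-m)) (f x)) ∧
      (∀ x m, f x (of i ^ m) = e (x m)) ∧ ∀ x, f x ∈ D i := by
  classical
  choose ρ s hs hwin using fun (i : α) (k : ℕ) => GameForest.exists_winning (turn i) (hD i)
    (fun _ => k)
  have hII : ∀ k, ∃ i, ρ i k = true := by
    intro k
    by_contra! hI
    let S : FreeGroup α → (FreeGroup α → ℕ) → ℕ := fun g y =>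
      if h : g = 1 then k else s (exists_headIs h).choose k g y
    obtain ⟨y, hy⟩ := exists_fixed_of_rank (rk := norm) (S := S) fun g y y' h => by
      by_cases hg : g = 1
      · simp [S, hg]
      · simp only [S, dif_neg hg]
        exact hs _ _ _ _ _ fun h' hh' => h h' (norm_lt_of_turn (exists_headIs hg).choose_spec hh')
    obtain ⟨i, hi⟩ := hcov y
    refine hI i ((hwin i k y (fun h hh => ?_) fun g j hj hjρ => ?_).1 hi)
    · rw [turn_eq_zero hh, hy]
      simp [S]
    · have hg : HeadIs i g := (headIs_of_turn hj).2 (by rw [hjρ]; simpa using hI i)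
      rw [hy]
      simp only [S, dif_neg hg.ne_one]
      rw [(exists_headIs hg.ne_one).choose_spec.eq hg]
  choose I hI using hII
  obtain ⟨i, hi⟩ := Finite.exists_infinite_fiber I
  have hinf : (I ⁻¹' {i}).Infinite := Set.infinite_coe_iff.1 hi
  let e : ℕ → ℕ := fun k => Nat.nth (fun k => k ∈ I ⁻¹' {i}) k
  have he : e.Injective := Nat.nth_injective hinf
  have hρ : ∀ k, ρ i (e k) = true := fun k => by
    have : I (e k) = i := Nat.nth_mem_of_infinite hinf k
    have h2 := hI (e k)
    rwa [this] at h2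
  let S : (ℤ → ℕ) → FreeGroup α → (FreeGroup α → ℕ) → ℕ := fun x g y =>
    if rest i g = 1 then e (x (lead i g))
    else s i (e (x (lead i g))) (rest i g) (fun β => y (of i ^ lead i g * β))
  have hS : ∀ x g y y', (∀ h, (rest i h).norm < (rest i g).norm → y h = y' h) →
      S x g y = S x g y' := by
    intro x g y y' h
    simp only [S]
    split_ifs with h1
    · rfl
    · refine hs _ _ _ _ _ fun β hβ => h _ ?_
      rw [(lead_rest_zpow_mul _ _ _).2]
      exact norm_rest_lt_of_turn (not_headIs_rest i g) hβ
  choose f hf using fun x => exists_fixed_of_rank (hS x)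
  have hshift : ∀ x m, f (fun k => x (k + m)) = shift (of i ^ (-m)) (f x) := by
    intro x m
    refine fixed_unique_of_rank (hS fun k => x (k + m)) (hf _) fun g => ?_
    have h1 := lead_rest_zpow_mul i m g
    simp only [shift, zpow_neg, inv_inv]
    rw [hf x]
    simp only [S, h1.1, h1.2, add_comm m, zpow_add, mul_assoc]
    have hc : ∀ β, of i ^ lead i g * (of i ^ m * β) = of i ^ m * (of i ^ lead i g * β) := fun β => by
      rw [← mul_assoc, ← mul_assoc, ← zpow_add, ← zpow_add, add_comm]
    simp only [hc, shift, inv_inv]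
  have hone : ∀ x, f x 1 = e (x 0) := by
    intro x
    have := rest_of_not_headIs (not_headIs_one i)
    rw [hf x]
    simp [S, this.1, this.2]
  refine ⟨i, e, f, he, ?_, hshift, fun x m => ?_, fun x => ?_⟩
  · have key : ∀ k g, (rest i g).norm < k → ∀ x, ∀ᶠ x' in nhds x, f x' g = f x g := by
      intro k
      induction k with
      | zero => intro _ h; omega
      | succ k ih =>
        intro g hg x
        have h1 : ∀ᶠ x' in nhds x, x' (lead i g) = x (lead i g) :=
          (continuous_apply (lead i g)).continuousAt.eventually
            (show ∀ᶠ v in nhds (x (lead i g)), v = x (lead i g) by simp)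
        have h2 : ∀ᶠ x' in nhds x, ∀ β ∈ {β : FreeGroup α | turn i β < turn i (rest i g)},
            f x' (of i ^ lead i g * β) = f x (of i ^ lead i g * β) := by
          rw [Filter.eventually_all_finite]
          · intro β hβ
            refine ih _ ?_ x
            rw [(lead_rest_zpow_mul _ _ _).2]
            have := norm_rest_lt_of_turn (not_headIs_rest i g) hβ
            omega
          · refine (finite_norm_lt (turn i (rest i g) + 1)).subset fun β hβ => ?_
            simp only [Set.mem_ofPred_eq] at hβ ⊢
            have : β.norm ≤ turn i β := by
              simp only [turn]
              split_ifs <;> omega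
            omega
        filter_upwards [h1, h2] with x' h1 h2
        rw [hf x', hf x]
        simp only [S, h1]
        split_ifs
        · rfl
        · exact hs _ _ _ _ _ fun β hβ => h2 β hβ
    refine continuous_pi fun g => continuous_iff_continuousAt.2 fun x => ?_
    exact tendsto_const_nhds.congr' ((key _ g (Nat.lt_succ_self _) x).mono fun _ h => h.symm)
  · have h1 := congrFun (hshift x m) 1
    rw [hone] at h1
    simpa [shift] using h1.symm
  · refine (hwin i (e (x 0)) (f x) (fun h hh => ?_) fun g j hj hjρ => ?_).2 (hρ _)
    · rw [turn_eq_zero hh, hone]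
    · have hg : ¬ HeadIs i g := fun h => by
        have := (headIs_of_turn hj).1 h
        rw [hρ] at hjρ
        rw [hjρ] at this
        simp at this
      have h1 := rest_of_not_headIs hg
      have hg1 : g ≠ 1 := by
        rintro rfl
        simp [turn, not_headIs_one] at hj
      rw [hf x]
      simp [S, h1.1, h1.2, hg1]

theorem measurableSet_forall {X : Type*} [MeasurableSpace X] {ι : Sort*} [Countable ι]
    {p : ι → X → Prop} (h : ∀ i, MeasurableSet {x | p i x}) :
    MeasurableSet {x | ∀ i, p i x} :=
  Set.ofPred_forall p ▸ MeasurableSet.iInter h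

theorem measurableSet_exists {X : Type*} [MeasurableSpace X] {ι : Sort*} [Countable ι]
    {p : ι → X → Prop} (h : ∀ i, MeasurableSet {x | p i x}) :
    MeasurableSet {x | ∃ i, p i x} :=
  Set.ofPred_exists p ▸ MeasurableSet.iUnion h

namespace FreeGroup

variable {α : Type} {X : Type} [MulAction (FreeGroup α) X]

/-- The points `q` of `U` fixed by `w` such that the suffixes of `w` move `q` along a simple cycle
which meets `U` in `q` only. -/
def simpleCycles (w : List (α × Bool)) (U : Set X) : Set X :=
  {q | mk w ≠ 1 ∧ mk w • q = q ∧ q ∈ U ∧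
    (∀ s t, s < t → t < w.length → mk (w.drop s) • q ≠ mk (w.drop t) • q) ∧
    ∀ s t, s < w.length → t < w.length →
      ((mk (w.drop t))⁻¹ * mk (w.drop s)) • q ∈ U →
        ((mk (w.drop t))⁻¹ * mk (w.drop s)) • q = q}

theorem measurableSet_simpleCycles [TopologicalSpace X] [T2Space X] [MeasurableSpace X]
    [BorelSpace X] (hc : ∀ g : FreeGroup α, Continuous fun x : X => g • x)
    (w : List (α × Bool)) {U : Set X} (hU : MeasurableSet U) :
    MeasurableSet (simpleCycles w U) := by
  have heq : ∀ g h : FreeGroup α, MeasurableSet {x : X | g • x = h • x} := fun g h =>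
    (isClosed_eq (hc g) (hc h)).measurableSet
  have heq' : ∀ g : FreeGroup α, MeasurableSet {x : X | g • x = x} := fun g =>
    (isClosed_eq (hc g) continuous_id).measurableSet
  refine (MeasurableSet.const _).inter ((heq' _).inter (hU.inter (MeasurableSet.inter ?_ ?_)))
  · have : ∀ s t : ℕ, MeasurableSet {q : X | s < t → t < w.length →
        mk (w.drop s) • q ≠ mk (w.drop t) • q} := fun s t => by
      exact measurableSet_forall fun _ => measurableSet_forall fun _ => (heq _ _).compl
    exact measurableSet_forall fun s => measurableSet_forall fun t => this s t
  · have : ∀ s t : ℕ, MeasurableSet {q : X | s < w.length → t < w.length →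
        ((mk (w.drop t))⁻¹ * mk (w.drop s)) • q ∈ U →
          ((mk (w.drop t))⁻¹ * mk (w.drop s)) • q = q} := fun s t => by
      have h1 := (hc ((mk (w.drop t))⁻¹ * mk (w.drop s))).measurable hU
      have h2 := h1.compl.union (heq' ((mk (w.drop t))⁻¹ * mk (w.drop s)))
      refine measurableSet_forall fun _ => measurableSet_forall fun _ => ?_
      convert h2 using 1
      ext q
      exact imp_iff_not_or
    exact measurableSet_forall fun s => measurableSet_forall fun t => this s t

theorem simpleCycles_unique {w : List (α × Bool)} {U : Set X} {q q' : X}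
    (hq : q ∈ simpleCycles w U) (hq' : q' ∈ simpleCycles w U) {s t : ℕ} (hs : s < w.length)
    (ht : t < w.length) (h : mk (w.drop s) • q = mk (w.drop t) • q') : s = t := by
  have h1 : ((mk (w.drop t))⁻¹ * mk (w.drop s)) • q = q' := by
    rw [mul_smul, h, inv_smul_smul]
  have h2 : q' = q := by
    rw [← h1]
    exact hq.2.2.2.2 s t hs ht (by rw [h1]; exact hq'.2.2.1)
  subst h2
  rcases lt_trichotomy s t with hst | hst | hst
  · exact (hq.2.2.2.1 s t hst ht h).elim
  · exact hst
  · exact (hq.2.2.2.1 t s hst hs h.symm).elim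

theorem exists_mem_simpleCycles [TopologicalSpace X] [T1Space X] {b : Set (Set X)}
    (hb : TopologicalSpace.IsTopologicalBasis b) {g : FreeGroup α} (hg : g ≠ 1) {y : X}
    (hy : g • y = y) :
    ∃ (w : List (α × Bool)), ∃ U ∈ b, ∃ h : FreeGroup α, h • y ∈ simpleCycles w U := by
  classical
  have hex : ∃ k, ∃ (w : List (α × Bool)) (h : FreeGroup α), w.length = k ∧ mk w ≠ 1 ∧
      mk w • h • y = h • y :=
    ⟨_, g.toWord, 1, rfl, by rwa [mk_toWord], by rwa [mk_toWord, one_smul]⟩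
  obtain ⟨w, h, hwl, hw1, hwy⟩ := Nat.find_spec hex
  have hmin : ∀ (w' : List (α × Bool)) (h' : FreeGroup α), w'.length < w.length → mk w' ≠ 1 →
      mk w' • h' • y ≠ h' • y := fun w' h' hl h1 h2 =>
    Nat.find_min hex (hwl ▸ hl) ⟨w', h', rfl, h1, h2⟩
  let T : Set X := (fun p : ℕ × ℕ => ((mk (w.drop p.1))⁻¹ * mk (w.drop p.2)) • h • y) ''
    (Set.Iio w.length ×ˢ Set.Iio w.length) \ {h • y}
  have hT : T.Finite := (((Set.finite_Iio _).prod (Set.finite_Iio _)).image _).subset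
    Set.sdiff_subset
  obtain ⟨U, hUb, hqU, hUT⟩ := hb.exists_subset_of_mem_open
    (show h • y ∈ Tᶜ from fun hm => hm.2 rfl) hT.isClosed.isOpen_compl
  refine ⟨w, U, hUb, h, hw1, hwy, hqU, fun s t hst ht heq => ?_, fun s t hs ht hU => ?_⟩
  · have hd : w.drop s = (w.drop s).take (t - s) ++ w.drop t := by
      conv_lhs => rw [← List.take_append_drop (t - s) (w.drop s)]
      rw [List.drop_drop]
      congr 2
      omega
    set B := (w.drop s).take (t - s)
    have hm : mk (w.drop s) = mk B * mk (w.drop t) := by rw [mul_mk, ← hd]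
    have hB : mk B = 1 := by
      by_contra hB
      refine hmin B (mk (w.drop t) * h) ?_ hB ?_
      · simp [B]
        omega
      · rw [mul_smul, ← mul_smul (mk B), ← hm, heq]
    have hw : mk (w.take s ++ w.drop t) = mk w := by
      conv_rhs => rw [← List.take_append_drop s w, ← mul_mk, hm, hB, one_mul, mul_mk]
    refine hmin (w.take s ++ w.drop t) h ?_ (hw ▸ hw1) (hw ▸ hwy)
    simp
    omega
  · by_contra hne
    exact hUT hU ⟨⟨(t, s), ⟨ht, hs⟩, rfl⟩, hne⟩

end FreeGroup

namespace FreeGroup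

theorem mk_mem_zpowers {α : Type} {i : α} {w : List (α × Bool)}
    (hw : ∀ t, (ht : t < w.length) → w[t].1 = i) : mk w ∈ Subgroup.zpowers (of i) := by
  induction w with
  | nil => exact Subgroup.one_mem _
  | cons a L ih =>
    have h0 : a.1 = i := hw 0 (by simp)
    have h1 : mk (a :: L) = mk [a] * mk L := by rw [mul_mk]; rfl
    rw [h1]
    refine Subgroup.mul_mem _ ?_ (ih fun t ht => hw (t + 1) (by simpa using ht))
    obtain ⟨j, b⟩ := a
    subst h0
    cases b
    · have : mk [(j, false)] = (of j)⁻¹ := rfl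
      exact this ▸ Subgroup.inv_mem _ (Subgroup.mem_zpowers _)
    · exact Subgroup.mem_zpowers _

/-- A Borel way of directing the points with a nontrivial stabilizer towards a cycle. -/
theorem exists_nonfree_cover {α : Type} [DecidableEq α] [Countable α] {X : Type}
    [MulAction (FreeGroup α) X] [TopologicalSpace X] [T2Space X]
    [SecondCountableTopology X] [MeasurableSpace X] [BorelSpace X]
    (hc : ∀ g : FreeGroup α, Continuous fun x : X => g • x) :
    ∃ B : α → Set X, (∀ i, MeasurableSet (B i)) ∧
      (∀ i, ∀ y ∈ B i, ∃ g : FreeGroup α, g ≠ 1 ∧ g • y = y) ∧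
      (∀ y : X, (∃ g : FreeGroup α, g ≠ 1 ∧ g • y = y) → ∃ i, y ∈ B i) ∧
      ∀ i y, (∀ m : ℤ, of i ^ m • y ∈ B i) → ∃ p : ℤ, p ≠ 0 ∧ of i ^ p • y = y := by
  have : Countable (FreeGroup α) := toWord_injective.countable
  obtain ⟨b, hbc, -, hb⟩ := TopologicalSpace.exists_countable_basis X
  have : Countable b := hbc.to_subtype
  obtain ⟨κ, hκ⟩ := exists_injective_nat (List (α × Bool) × b)
  let Z : List (α × Bool) × b → Set X := fun c => simpleCycles c.1 c.2
  have hZ : ∀ c, MeasurableSet (Z c) := fun c =>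
    measurableSet_simpleCycles hc c.1 (hb.isOpen c.2.2).measurableSet
  let Z' : List (α × Bool) × b → Set X := fun c =>
    {q | q ∈ Z c ∧ ∀ c', κ c' < κ c → ∀ g : FreeGroup α, g • q ∉ Z c'}
  have hZ' : ∀ c, MeasurableSet (Z' c) := fun c => (hZ c).inter <|
    measurableSet_forall fun c' => measurableSet_forall fun _ => measurableSet_forall fun g =>
      ((hc g).measurable (hZ c')).compl
  have hZu : ∀ c c' q q' (g : FreeGroup α), q ∈ Z' c → q' ∈ Z' c' → g • q = q' → c = c' := by
    intro c c' q q' g hq hq' h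
    rcases lt_trichotomy (κ c) (κ c') with hlt | heq | hlt
    · exact (hq'.2 c hlt g⁻¹ (by rw [← h, inv_smul_smul]; exact hq.1)).elim
    · exact hκ heq
    · exact (hq.2 c' hlt g (h ▸ hq'.1)).elim
  let R : List (α × Bool) × b → ℕ → Set X := fun c s =>
    {y | s < c.1.length ∧ (mk (c.1.drop s))⁻¹ • y ∈ Z' c}
  have hR : ∀ c s, MeasurableSet (R c s) := fun c s =>
    (MeasurableSet.const _).inter ((hc _).measurable (hZ' c))
  have hRu : ∀ c c' s s' y, y ∈ R c s → y ∈ R c' s' → c = c' ∧ s = s' := by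
    intro c c' s s' y h h'
    have hcc := hZu c c' _ _ ((mk (c'.1.drop s'))⁻¹ * mk (c.1.drop s)) h.2 h'.2
      (by rw [mul_smul, smul_inv_smul])
    subst hcc
    refine ⟨rfl, simpleCycles_unique h.2.1 h'.2.1 h.1 h'.1 ?_⟩
    rw [smul_inv_smul, smul_inv_smul]
  let P : Set X := {y | ∃ c s, y ∈ R c s}
  have hP : MeasurableSet P := measurableSet_exists fun c => measurableSet_exists fun s => hR c s
  let B₁ : α → Set X := fun i => {y | ∃ g : FreeGroup α, HeadIs i g ∧ g⁻¹ • y ∈ P ∧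
    ∀ h : FreeGroup α, h.norm < g.norm → h⁻¹ • y ∉ P}
  let B₂ : α → Set X := fun i => {y | ∃ c s, (∃ h : s < c.1.length, c.1[s].1 = i) ∧ y ∈ R c s}
  have hPfix : ∀ y ∈ P, ∃ g : FreeGroup α, g ≠ 1 ∧ g • y = y := by
    rintro y ⟨c, s, -, ⟨h1, h2, -⟩, -⟩
    refine ⟨mk (c.1.drop s) * mk c.1 * (mk (c.1.drop s))⁻¹, ?_, ?_⟩
    · rwa [Ne, conj_eq_one_iff]
    · rw [mul_smul, mul_smul, h2, smul_inv_smul]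
  refine ⟨fun i => B₁ i ∪ B₂ i, fun i => ?_, ?_, ?_, ?_⟩
  · refine MeasurableSet.union ?_ ?_
    · exact measurableSet_exists fun g => (MeasurableSet.const _).inter <|
        ((hc _).measurable hP).inter <| measurableSet_forall fun h => measurableSet_forall fun _ =>
          ((hc _).measurable hP).compl
    · exact measurableSet_exists fun c => measurableSet_exists fun s =>
        (MeasurableSet.const _).inter (hR c s)
  · rintro i y (⟨g, -, h, -⟩ | ⟨c, s, -, h⟩)
    · obtain ⟨g', h1, h2⟩ := hPfix _ h
      refine ⟨g * g' * g⁻¹, by rwa [Ne, conj_eq_one_iff], ?_⟩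
      rw [mul_smul, mul_smul, h2, smul_inv_smul]
    · exact hPfix _ ⟨c, s, h⟩
  · rintro y ⟨g, hg, hy⟩
    have hex : ∃ k, ∃ g : FreeGroup α, g.norm = k ∧ g⁻¹ • y ∈ P := by
      obtain ⟨w, U, hU, h, hw⟩ := exists_mem_simpleCycles hb hg hy
      have hex : ∃ k c, κ c = k ∧ ∃ h : FreeGroup α, h • y ∈ Z c := ⟨_, ⟨w, U, hU⟩, rfl, h, hw⟩
      classical
      obtain ⟨c, hck, h', hh⟩ := Nat.find_spec hex
      have hh' : h' • y ∈ Z' c := ⟨hh, fun c' hlt g hg =>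
        Nat.find_min hex (hck ▸ hlt) ⟨c', rfl, g * h', by rwa [mul_smul]⟩⟩
      refine ⟨_, h'⁻¹, rfl, c, 0, List.length_pos_iff.2 fun hnil => hh.1 (by rw [hnil]; rfl), ?_⟩
      rw [inv_inv, List.drop_zero, ← hh.2.1, inv_smul_smul]
      exact hh'
    classical
    obtain ⟨g, hgk, hg⟩ := Nat.find_spec hex
    by_cases h1 : g = 1
    · subst h1
      obtain ⟨c, s, h⟩ := hg
      rw [inv_one, one_smul] at h
      exact ⟨_, Or.inr ⟨c, s, ⟨h.1, rfl⟩, h⟩⟩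
    · obtain ⟨i, hi⟩ := exists_headIs h1
      exact ⟨i, Or.inl ⟨g, hi, hg, fun h hlt hm => Nat.find_min hex (hgk ▸ hlt) ⟨h, rfl, hm⟩⟩⟩
  · intro i y hy
    have hR₂ : ∀ m : ℤ, ∀ c s, of i ^ m • y ∈ R c s → ∃ h : s < c.1.length, c.1[s].1 = i := by
      intro m c s hm
      rcases hy m with ⟨g, hi, -, hg⟩ | ⟨c', s', hs', hm'⟩
      · refine (hg 1 ?_ (by rw [inv_one, one_smul]; exact ⟨c, s, hm⟩)).elim
        rw [norm_one]
        exact norm_pos hi.ne_one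
      · obtain ⟨rfl, rfl⟩ := hRu _ _ _ _ _ hm hm'
        exact hs'
    have hmeet : ∃ m : ℤ, of i ^ m • y ∈ P := by
      have key : ∀ k, ∀ g : FreeGroup α, g.norm < k → ∀ m : ℤ, g⁻¹ • of i ^ m • y ∈ P →
          ∃ m : ℤ, of i ^ m • y ∈ P := by
        intro k
        induction k with
        | zero => intro _ h; omega
        | succ k ih =>
          intro g hg m hm
          rcases hy m with ⟨g', hi, hg', hmin⟩ | ⟨c, s, -, h⟩
          · have h1 : g'.norm ≤ g.norm := not_lt.1 fun h => hmin g h hm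
            refine ih (rest i g') (by have := norm_rest_lt hi; omega) (-lead i g' + m) ?_
            rw [zpow_add, mul_smul, ← mul_smul, zpow_neg, ← mul_inv_rev, lead_mul_rest]
            exact hg'
          · exact ⟨m, c, s, h⟩
      rcases hy 0 with ⟨g', -, hg', -⟩ | ⟨c, s, -, h⟩
      · exact key _ g' (Nat.lt_succ_self _) 0 hg'
      · exact ⟨0, c, s, h⟩
    obtain ⟨m, c, s, hm⟩ := hmeet
    obtain ⟨q, hq, hqy⟩ : ∃ q ∈ Z' c, of i ^ m • y = mk (c.1.drop s) • q :=
      ⟨_, hm.2, (smul_inv_smul _ _).symm⟩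
    have hstep : ∀ t, t < c.1.length → (∃ m : ℤ, of i ^ m • y = mk (c.1.drop t) • q) →
        (∃ h : t < c.1.length, c.1[t].1 = i) ∧
          ∃ m : ℤ, of i ^ m • y = mk (c.1.drop (t + 1)) • q := by
      rintro t ht ⟨m, hm⟩
      have h1 := hR₂ m c t ⟨ht, by rw [hm, inv_smul_smul]; exact hq⟩
      refine ⟨h1, ?_⟩
      obtain ⟨_, h2⟩ := h1
      have h3 : mk (c.1.drop t) = mk [c.1[t]] * mk (c.1.drop (t + 1)) := by
        rw [List.drop_eq_getElem_cons ht, mul_mk]; rfl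
      have h4 : mk [c.1[t]] ∈ Subgroup.zpowers (of i) := mk_mem_zpowers fun j hj => by
        have : j = 0 := by simpa using hj
        subst this
        exact h2
      obtain ⟨j, hj⟩ := h4
      refine ⟨-j + m, ?_⟩
      simp only at hj
      rw [zpow_add, mul_smul, hm, h3, mul_smul, ← hj, zpow_neg, inv_smul_smul]
    have hend : ∀ t, s ≤ t → t ≤ c.1.length → ∃ m : ℤ, of i ^ m • y = mk (c.1.drop t) • q := by
      intro t hst
      induction t, hst using Nat.le_induction with
      | base => exact fun _ => ⟨m, hqy⟩
      | succ t _ ih => exact fun ht => (hstep t ht (ih (by omega))).2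
    obtain ⟨m', hm'⟩ := hend c.1.length hm.1.le le_rfl
    rw [List.drop_length] at hm'
    replace hm' : of i ^ m' • y = q := hm'.trans (one_smul _ q)
    have hall : ∀ t, t ≤ c.1.length → ∃ m : ℤ, of i ^ m • y = mk (c.1.drop t) • q := by
      intro t
      induction t with
      | zero => exact fun _ => ⟨m', by rw [List.drop_zero, hq.1.2.1, hm']⟩
      | succ t ih => exact fun ht => (hstep t ht (ih (by omega))).2
    obtain ⟨p, hp⟩ := mk_mem_zpowers (w := c.1) (i := i) fun t ht =>
      (hstep t ht (hall t ht.le)).1.2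
    simp only at hp
    refine ⟨p, fun h0 => hq.1.1 (by rw [← hp, h0, zpow_zero]), ?_⟩
    have h5 := hq.1.2.1
    rw [← hp, ← hm', ← mul_smul, ← zpow_add, add_comm, zpow_add, mul_smul] at h5
    exact smul_left_cancel _ h5

end FreeGroup

open Filter in
/-- The shift of `ℤ → ℕ` has no Baire measurable 2-coloring, even on its aperiodic part. -/
theorem not_flipped_of_measurableSet {P : Set (ℤ → ℕ)} (hP : MeasurableSet P) :
    ¬ ∀ x : ℤ → ℕ, (∀ p : ℤ, p ≠ 0 → (fun k => x (k + p)) ≠ x) →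
      ((fun k => x (k + 1)) ∈ P ↔ x ∉ P) := by
  intro hflip
  let σ : ℤ → (ℤ → ℕ) ≃ₜ (ℤ → ℕ) := fun p =>
    { toFun := fun x k => x (k + p)
      invFun := fun x k => x (k - p)
      left_inv := fun x => by simp
      right_inv := fun x => by simp
      continuous_toFun := by fun_prop
      continuous_invFun := by fun_prop }
  have haper : ∀ᶠ x in residual (ℤ → ℕ), ∀ p : ℤ, p ≠ 0 → σ p x ≠ x := by
    rw [eventually_countable_forall]
    intro p
    by_cases hp : p = 0
    · simp [hp]
    refine Eventually.mono (residual_of_dense_open (s := {x | σ p x ≠ x}) ?_ ?_) fun x hx _ => hx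
    · exact (isClosed_eq (σ p).continuous continuous_id).isOpen_compl
    · refine dense_iff_inter_open.2 fun U hU ⟨x, hx⟩ => ?_
      obtain ⟨I, u, hu, hIU⟩ := isOpen_pi_iff.1 hU x hx
      obtain ⟨k, hk⟩ := Infinite.exists_notMem_finset I
      refine ⟨Function.update x k (x (k + p) + 1), hIU fun j hj => ?_, fun h => ?_⟩
      · rw [Function.update_of_ne (ne_of_mem_of_not_mem hj hk)]
        exact (hu j hj).2
      · have h1 := congrFun h k
        change Function.update x k _ (k + p) = _ at h1
        rw [Function.update_self, Function.update_of_ne (by omega)] at h1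
        omega
  have hiter : ∀ t : ℕ, ∀ x, (∀ p : ℤ, p ≠ 0 → σ p x ≠ x) →
      (σ t x ∈ P ↔ (x ∈ P ↔ Even t)) := by
    intro t
    induction t with
    | zero => intro x _; simp [σ]
    | succ t ih =>
      intro x hx
      have hx' : ∀ p : ℤ, p ≠ 0 → σ p (σ t x) ≠ σ t x := fun p hp h => hx p hp <|
        (σ t).injective <| by
          rw [← h]
          funext k
          simp only [σ, Homeomorph.homeomorph_mk_coe, Equiv.coe_fn_mk]
          congr 1
          omega
      have h1 := hflip (σ t x) hx'
      have h2 : σ (t + 1 : ℕ) x = fun k => σ t x (k + 1) := by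
        funext k
        simp only [σ, Homeomorph.homeomorph_mk_coe, Equiv.coe_fn_mk]
        congr 1
        push_cast
        omega
      rw [h2, h1, ih x hx, Nat.even_add_one]
      tauto
  obtain ⟨u, hu, hPu⟩ := hP.residualEq_isOpen
  have hshift : ∀ p : ℤ, ∀ᶠ x in residual (ℤ → ℕ), (σ p x ∈ P) = (σ p x ∈ u) := fun p =>
    (tendsto_residual_of_isOpenMap (σ p).continuous (σ p).isOpenMap).eventually hPu
  rcases u.eq_empty_or_nonempty with rfl | ⟨x₀, hx₀⟩
  · obtain ⟨x, h1, h2, h3⟩ := (dense_of_mem_residual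
      (haper.and ((hshift 0).and (hshift 1)))).nonempty
    have h4 := hiter 1 x h1
    have h5 := hiter 0 x h1
    simp_all
  · obtain ⟨I, v, hv, hIu⟩ := isOpen_pi_iff.1 hu x₀ hx₀
    obtain ⟨M, hM⟩ : ∃ M : ℕ, ∀ k ∈ I, |k| ≤ M :=
      ⟨I.sup Int.natAbs, fun k hk => by
        have := Finset.le_sup (f := Int.natAbs) hk
        rw [Int.abs_eq_natAbs]
        exact_mod_cast this⟩
    have hne : (u ∩ σ (2 * M + 1 : ℕ) ⁻¹' u).Nonempty := by
      refine ⟨fun k => if |k| ≤ M then x₀ k else x₀ (k - (2 * M + 1 : ℕ)), hIu fun k hk => ?_,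
        hIu fun k hk => ?_⟩
      · simp only [if_pos (hM k hk)]
        exact (hv k hk).2
      · have h6 := hM k hk
        have h7 : ¬ |k + (2 * M + 1 : ℕ)| ≤ M := by
          rw [abs_le] at h6 ⊢
          push_cast
          omega
        simp only [σ, Homeomorph.homeomorph_mk_coe, Equiv.coe_fn_mk, if_neg h7, add_sub_cancel_right]
        exact (hv k hk).2
    obtain ⟨x, ⟨h1, h2⟩, h3, h4, h5⟩ := (dense_of_mem_residual
      (haper.and ((hshift 0).and (hshift (2 * M + 1 : ℕ))))).inter_open_nonempty _
      (hu.inter (hu.preimage (σ _).continuous)) hne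
    have h6 := hiter (2 * M + 1) x h3
    have h8 : ¬ Even (2 * M + 1) := by simp
    have h0 : σ 0 x = x := by simp [σ]
    rw [h0] at h4
    rw [h5, h4] at h6
    exact h8 ((h6.1 h2).1 h1)

theorem shift_one {G X : Type*} [Group G] (y : G → X) : shift 1 y = y := by
  funext _
  simp [shift]

theorem shift_mul {G X : Type*} [Group G] (g h : G) (y : G → X) :
    shift (g * h) y = shift g (shift h y) := by
  funext _
  simp [shift, mul_assoc]

theorem continuous_shift {G X : Type*} [Group G] [TopologicalSpace X] (g : G) :
    Continuous (shift g : (G → X) → G → X) :=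
  continuous_pi fun _ => continuous_apply _

theorem shift_mem_freePart {G X : Type*} [Group G] {y : G → X} (hy : y ∈ freePart G X) (g : G) :
    shift g y ∈ freePart G X := by
  intro γ hγ h
  refine hy (g⁻¹ * γ * g) (fun h1 => hγ ?_) ?_
  · have := congrArg (fun z => g * z * g⁻¹) h1
    simpa [mul_assoc] using this
  · rw [shift_mul, shift_mul, h, ← shift_mul, inv_mul_cancel, shift_one]

theorem measurableSet_freePart (G : Type*) [Group G] [Countable G] :
    MeasurableSet (freePart G ℕ) :=
  measurableSet_forall fun γ => measurableSet_forall fun _ =>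
    (isClosed_eq (continuous_shift γ) continuous_id).measurableSet.compl

/-- Marks' theorem: the free part of the shift of a free group of rank `n` has no Borel
`2 n`-coloring. -/
theorem not_coloring {α : Type} [DecidableEq α] [Finite α]
    {c : freePart (FreeGroup α) ℕ → α × Bool} (hc : ∀ k, MeasurableSet (c ⁻¹' {k})) :
    ∃ x y, cayleyAdj (Set.range FreeGroup.of) ℕ x y ∧ c x = c y := by
  by_contra! hcol
  have : Countable (FreeGroup α) := FreeGroup.toWord_injective.countable
  let act : MulAction (FreeGroup α) (FreeGroup α → ℕ) :=
    { smul := shift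
      one_smul := shift_one
      mul_smul := shift_mul }
  obtain ⟨B, hB, hBfix, hBcov, hBper⟩ := FreeGroup.exists_nonfree_cover
    (X := FreeGroup α → ℕ) continuous_shift
  let C : α × Bool → Set (FreeGroup α → ℕ) := fun k => Subtype.val '' (c ⁻¹' {k})
  have hC : ∀ k, MeasurableSet (C k) := fun k =>
    (measurableSet_freePart _).subtype_image (hc k)
  have hnfree : ∀ i, ∀ y ∈ B i, y ∉ freePart (FreeGroup α) ℕ := fun i y hy hf => by
    obtain ⟨g, hg, hgy⟩ := hBfix i y hy
    exact hf g hg hgy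
  obtain ⟨i, e, f, he, hfc, hfs, hfe, hfD⟩ := exists_line_map
    (D := fun i => C (i, true) ∪ C (i, false) ∪ B i)
    (fun i => ((hC _).union (hC _)).union (hB i)) fun y => by
      by_cases hy : y ∈ freePart (FreeGroup α) ℕ
      · refine ⟨(c ⟨y, hy⟩).1, Or.inl ?_⟩
        rcases h : (c ⟨y, hy⟩).2 with _ | _
        · exact Or.inr ⟨⟨y, hy⟩, Prod.ext rfl h, rfl⟩
        · exact Or.inl ⟨⟨y, hy⟩, Prod.ext rfl h, rfl⟩
      · simp only [freePart, Set.mem_ofPred_eq, not_forall, not_not, exists_prop] at hy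
        exact (hBcov y hy).imp fun _ h => Or.inr h
  have hfree : ∀ x, (∀ p : ℤ, p ≠ 0 → (fun k => x (k + p)) ≠ x) →
      f x ∈ freePart (FreeGroup α) ℕ := by
    intro x hx
    by_contra hnf
    obtain ⟨p, hp, hfp⟩ := hBper i (f x) fun m => by
      change shift _ _ ∈ _
      have h1 := hfs x (-m)
      rw [neg_neg] at h1
      have h2 : shift (FreeGroup.of i ^ m) (f x) ∉ freePart (FreeGroup α) ℕ := fun h => by
        have := shift_mem_freePart h (FreeGroup.of i ^ m)⁻¹
        rw [← shift_mul, inv_mul_cancel, shift_one] at this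
        exact hnf this
      rcases hfD fun k => x (k + -m) with (⟨y, -, hy⟩ | ⟨y, -, hy⟩) | h
      · exact (h2 (h1 ▸ hy ▸ y.2)).elim
      · exact (h2 (h1 ▸ hy ▸ y.2)).elim
      · exact h1 ▸ h
    have h1 := hfs x (-p)
    rw [neg_neg] at h1
    refine hx (-p) (neg_ne_zero.2 hp) (funext fun m => he ?_)
    rw [← hfe x m, ← hfe (fun k => x (k + -p)) m, h1]
    exact congrFun hfp _
  have hcol' : ∀ x, (∀ p : ℤ, p ≠ 0 → (fun k => x (k + p)) ≠ x) →
      ∃ b, f x ∈ C (i, b) ∧ f x ∉ C (i, !b) := by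
    intro x hx
    have huniq : ∀ b b', f x ∈ C (i, b) → f x ∈ C (i, b') → b = b' := by
      rintro b b' ⟨y, hy, hyx⟩ ⟨y', hy', hyx'⟩
      obtain rfl : y = y' := Subtype.ext (hyx.trans hyx'.symm)
      have := hy.symm.trans hy'
      simpa using this
    rcases hfD x with (h | h) | h
    · exact ⟨true, h, fun h' => by simpa using huniq _ _ h h'⟩
    · exact ⟨false, h, fun h' => by simpa using huniq _ _ h h'⟩
    · exact (hnfree _ _ h (hfree x hx)).elim
  refine not_flipped_of_measurableSet (hfc.measurable (hC (i, true))) fun x hx => ?_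
  have hx' : ∀ p : ℤ, p ≠ 0 → (fun k => (fun k => x (k + 1)) (k + p)) ≠ fun k => x (k + 1) := by
    intro p hp h
    refine hx p hp (funext fun k => ?_)
    have := congrFun h (k - 1)
    simp only [sub_add_cancel] at this
    rwa [sub_add_eq_add_sub, sub_add_cancel] at this
  have hadj : ∀ k, f x ∈ C k → f (fun k => x (k + 1)) ∉ C k := by
    rintro k ⟨y, hy, hyx⟩ ⟨y', hy', hyx'⟩
    refine hcol y' y ⟨_, ⟨i, rfl⟩, Or.inl ?_⟩ (hy'.trans hy.symm)
    rw [hyx, hyx', hfs x 1, ← shift_mul, zpow_neg, zpow_one, mul_inv_cancel, shift_one]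
  obtain ⟨b, hb, hb'⟩ := hcol' x hx
  obtain ⟨b', hb₁, hb₁'⟩ := hcol' (fun k => x (k + 1)) hx'
  have h1 := hadj (i, true)
  have h2 := hadj (i, false)
  simp only [Set.mem_preimage]
  cases b <;> cases b' <;> simp_all

/-- A Borel graph generated by finitely many fixed point free maps has a countable Borel
coloring. -/
theorem exists_measurable_nat_coloring {V : Type*} [TopologicalSpace V] [T1Space V]
    [SecondCountableTopology V] [MeasurableSpace V] [OpensMeasurableSpace V] {κ : Type*} [Finite κ]
    {T : κ → V → V} (hT : ∀ k, Measurable (T k)) (hne : ∀ k y, T k y ≠ y) :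
    ∃ c : V → ℕ, Measurable c ∧ ∀ k y, c (T k y) ≠ c y := by
  classical
  obtain ⟨B, hBc, -, hB⟩ := TopologicalSpace.exists_countable_basis V
  obtain ⟨b, hb⟩ := (hBc.insert ∅).exists_eq_range (Set.insert_nonempty _ _)
  have hbo : ∀ m, IsOpen (b m) := fun m => by
    rcases (hb ▸ Set.mem_range_self m : b m ∈ insert ∅ B) with h | h
    · exact h ▸ isOpen_empty
    · exact hB.isOpen h
  have hex : ∀ y, ∃ m, y ∈ b m ∧ ∀ k, T k y ∉ b m := fun y => by
    have hf : (Set.range fun k => T k y).Finite := Set.finite_range _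
    obtain ⟨U, hU, hyU, hUT⟩ := hB.exists_subset_of_mem_open
      (show y ∈ (Set.range fun k => T k y)ᶜ from fun ⟨k, hk⟩ => hne k y hk) hf.isClosed.isOpen_compl
    obtain ⟨m, rfl⟩ : U ∈ Set.range b := hb ▸ Set.mem_insert_of_mem _ hU
    exact ⟨m, hyU, fun k hk => hUT hk ⟨k, rfl⟩⟩
  refine ⟨fun y => Nat.find (hex y), measurable_find hex fun m => ?_, fun k y h => ?_⟩
  · exact (hbo m).measurableSet.inter
      (measurableSet_forall fun k => (hT k (hbo m).measurableSet).compl)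
  · have h1 := (Nat.find_spec (hex (T k y))).1
    simp only at h
    rw [h] at h1
    exact (Nat.find_spec (hex y)).2 k h1

/-- A Borel graph generated by `d` fixed point free Borel maps has a Borel `(d + 1)`-coloring. -/
theorem exists_measurable_coloring {V : Type} [TopologicalSpace V] [T1Space V]
    [SecondCountableTopology V] [MeasurableSpace V] [OpensMeasurableSpace V] {κ : Type*} [Fintype κ]
    {T : κ → V → V} (hT : ∀ k, Measurable (T k)) (hne : ∀ k y, T k y ≠ y)
    (hinv : ∀ k, ∃ k', ∀ y, T k' (T k y) = y) :
    ∃ c : V → Fin (Fintype.card κ + 1), Measurable c ∧ ∀ k y, c (T k y) ≠ c y := by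
  classical
  obtain ⟨r, hr, hrT⟩ := exists_measurable_nat_coloring hT hne
  obtain ⟨c, hc⟩ := exists_fixed_of_rank (rk := r)
    (S := fun y c => sInf {j | ∀ k, r (T k y) < r y → c (T k y) ≠ j}) fun y c c' h => by
      congr 1
      ext j
      exact forall_congr' fun k => forall_congr' fun hk => by rw [h _ hk]
  have hex : ∀ y, ∃ j ≤ Fintype.card κ, ∀ k, r (T k y) < r y → c (T k y) ≠ j := fun y => by
    obtain ⟨j, hj, hj'⟩ := Finset.exists_mem_notMem_of_card_lt_card
      (s := Finset.univ.image fun k => c (T k y)) (t := Finset.range (Fintype.card κ + 1))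
      (Finset.card_image_le.trans_lt (by simp))
    exact ⟨j, Nat.lt_succ_iff.1 (Finset.mem_range.1 hj),
      fun k _ h => hj' (Finset.mem_image.2 ⟨k, Finset.mem_univ _, h⟩)⟩
  have hle : ∀ y, c y < Fintype.card κ + 1 := fun y => by
    obtain ⟨j, hj, h⟩ := hex y
    have := Nat.sInf_le (s := {j | ∀ k, r (T k y) < r y → c (T k y) ≠ j}) h
    rw [← hc y] at this
    omega
  have hlow : ∀ y k, r (T k y) < r y → c (T k y) ≠ c y := fun y => by
    obtain ⟨j, hj, h⟩ := hex y
    have := Nat.sInf_mem (s := {j | ∀ k, r (T k y) < r y → c (T k y) ≠ j}) ⟨j, h⟩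
    rw [← hc y] at this
    exact this
  have hmeas : ∀ m, Measurable fun y => if r y < m then c y else 0 := by
    intro m
    induction m with
    | zero => simp
    | succ m ih =>
      let Φ : (κ → ℕ × ℕ) → ℕ := fun v => sInf {j | ∀ k, (v k).1 < m → (v k).2 ≠ j}
      have h1 : Measurable fun y => Φ fun k =>
          (r (T k y), if r (T k y) < m then c (T k y) else 0) :=
        (measurable_of_countable Φ).comp (measurable_pi_lambda _ fun k =>
          (hr.comp (hT k)).prodMk (ih.comp (hT k)))
      have h2 : Measurable fun y => if r y = m then Φ fun k =>
          (r (T k y), if r (T k y) < m then c (T k y) else 0) else if r y < m then c y else 0 :=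
        Measurable.ite (hr (measurableSet_singleton m)) h1 ih
      refine (funext fun y => ?_ : (fun y => if r y < m + 1 then c y else 0) = _) ▸ h2
      by_cases hy : r y = m
      · rw [if_pos (by omega), if_pos hy, hc y, hy]
        simp only [Φ]
        congr 1
        ext j
        exact forall_congr' fun k => forall_congr' fun hk => by rw [if_pos hk]
      · rw [if_neg hy]
        exact if_congr (by omega) rfl rfl
  have hcm : Measurable c := measurable_to_countable' fun j => by
    have : c ⁻¹' {j} = {y | ∃ m, r y < m ∧ (if r y < m then c y else 0) = j} := by
      ext y
      refine ⟨fun h => ⟨r y + 1, Nat.lt_succ_self _, by simpa using h⟩, ?_⟩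
      rintro ⟨m, hm, h⟩
      rwa [if_pos hm] at h
    rw [this]
    exact measurableSet_exists fun m => (hr measurableSet_Iio).inter
      (hmeas m (measurableSet_singleton j))
  refine ⟨fun y => ⟨c y, hle y⟩, ?_, fun k y h => ?_⟩
  · refine measurable_to_countable' fun j => ?_
    convert hcm (measurableSet_singleton j.1) using 1
    ext y
    exact Fin.ext_iff
  · replace h : c (T k y) = c y := congrArg Fin.val h
    rcases lt_or_gt_of_ne (hrT k y) with hlt | hlt
    · exact hlow y k hlt h
    · obtain ⟨k', hk'⟩ := hinv k
      refine hlow (T k y) k' ?_ ?_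
      · rwa [hk']
      · rw [hk', h]

theorem shift_injective_of_mem_freePart {G X : Type*} [Group G] {y : G → X}
    (hy : y ∈ freePart G X) {g h : G} (hgh : shift g y = shift h y) : g = h := by
  by_contra hne
  refine hy (h⁻¹ * g) (fun h1 => hne (inv_mul_eq_one.1 h1).symm) ?_
  rw [shift_mul, hgh, ← shift_mul, inv_mul_cancel, shift_one]

namespace FreeGroup

variable {α : Type} {X : Type}

/-- The action of a letter on the free part of the shift. -/
def letterShift (k : α × Bool) (x : freePart (FreeGroup α) X) : freePart (FreeGroup α) X :=
  ⟨shift (mk [k]) x, shift_mem_freePart x.2 _⟩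

theorem letterShift_injective (k : α × Bool) :
    (letterShift k : freePart (FreeGroup α) X → _).Injective := fun x y h => by
  have h1 := congrArg (fun z => shift (mk [k])⁻¹ (Subtype.val z)) h
  simp only [letterShift, ← shift_mul, inv_mul_cancel, shift_one] at h1
  exact Subtype.ext h1

theorem mk_not (k : α × Bool) : mk [(k.1, !k.2)] = (mk [k])⁻¹ := by
  simp [inv_mk, invRev]

theorem letterShift_not (k : α × Bool) (x : freePart (FreeGroup α) X) :
    letterShift (k.1, !k.2) (letterShift k x) = x := by
  refine Subtype.ext ?_
  change shift (mk [(k.1, !k.2)]) (shift (mk [k]) x.1) = x.1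
  rw [mk_not, ← shift_mul, inv_mul_cancel, shift_one]

theorem letterShift_left_injective (x : freePart (FreeGroup α) X) :
    Function.Injective fun k => letterShift k x := fun k k' h => by
  classical
  have h1 := congrArg toWord (shift_injective_of_mem_freePart x.2 (congrArg Subtype.val h))
  simpa using h1

theorem letterShift_ne (k : α × Bool) (x : freePart (FreeGroup α) X) : letterShift k x ≠ x :=
  fun h => by
    classical
    have h1 := congrArg toWord (shift_injective_of_mem_freePart x.2 (g := mk [k]) (h := 1)
      (by rw [shift_one]; exact congrArg Subtype.val h))
    simp at h1

theorem cayleyAdj_iff {x y : freePart (FreeGroup α) X} :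
    cayleyAdj (Set.range of) X x y ↔ ∃ k, letterShift k x = y := by
  constructor
  · rintro ⟨_, ⟨i, rfl⟩, h | h⟩
    · exact ⟨(i, true), Subtype.ext h⟩
    · refine ⟨(i, false), ?_⟩
      rw [← letterShift_not (i, true) y]
      exact congrArg _ (Subtype.ext h.symm)
  · rintro ⟨⟨i, _ | _⟩, rfl⟩
    · refine ⟨_, ⟨i, rfl⟩, Or.inr ?_⟩
      exact congrArg Subtype.val (letterShift_not (i, false) x)
    · exact ⟨_, ⟨i, rfl⟩, Or.inl rfl⟩

theorem measurable_letterShift (k : α × Bool) :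
    Measurable (letterShift k : freePart (FreeGroup α) ℕ → _) :=
  Measurable.subtype_mk (f := fun x : freePart (FreeGroup α) ℕ => shift (mk [k]) x.1) <|
    measurable_pi_lambda _ fun _ => (measurable_pi_apply _).comp measurable_subtype_coe

variable {H : SimpleGraph (freePart (FreeGroup α) X)}

theorem exists_isReduced_of_isTrail (hH : ∀ x y, H.Adj x y ↔ ∃ k, letterShift k x = y)
    {u v : freePart (FreeGroup α) X} (p : H.Walk u v) (hp : p.IsTrail) :
    ∃ L : List (α × Bool), IsReduced L ∧ L.length = p.length ∧ shift (mk L) v.1 = u ∧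
      ∀ k ∈ L.head?, ∃ w, letterShift k w = u ∧ s(u, w) ∈ p.edges := by
  induction p with
  | nil => exact ⟨[], IsReduced.nil, rfl, shift_one _, by simp⟩
  | @cons u w v h p ih =>
    rw [SimpleGraph.Walk.isTrail_cons] at hp
    obtain ⟨L, hL, hlen, hLv, hhead⟩ := ih hp.1
    obtain ⟨k, hk⟩ := (hH w u).1 h.symm
    refine ⟨k :: L, ?_, by simp [hlen], ?_, ?_⟩
    · refine List.isChain_cons.2 ⟨fun k' hk' h1 => ?_, hL⟩
      by_contra h2
      obtain ⟨w', hw', hmem⟩ := hhead k' hk'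
      have h3 : k' = (k.1, !k.2) := Prod.ext h1.symm (by
        rcases h4 : k.2 with _ | _ <;> rcases h5 : k'.2 with _ | _ <;> simp_all)
      have h4 : w' = u := letterShift_injective k' <| by rw [hw', h3, ← hk, letterShift_not]
      rw [h4, Sym2.eq_swap] at hmem
      exact hp.2 hmem
    · have : mk (k :: L) = mk [k] * mk L := by rw [mul_mk]; rfl
      rw [this, shift_mul, hLv]
      exact congrArg Subtype.val hk
    · rintro k' hk'
      obtain rfl : k = k' := by simpa using hk'
      exact ⟨w, hk, by simp⟩

theorem isAcyclic_of_adj_iff (hH : ∀ x y, H.Adj x y ↔ ∃ k, letterShift k x = y) :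
    H.IsAcyclic := by
  classical
  intro v p hp
  obtain ⟨L, hL, hlen, hLv, -⟩ := exists_isReduced_of_isTrail hH p hp.isTrail
  have h1 : mk L = 1 := shift_injective_of_mem_freePart v.2 (hLv.trans (shift_one _).symm)
  have h2 : L = [] := by
    rw [← hL.reduce_eq, ← toWord_mk, h1, toWord_one]
  have := hp.three_le_length
  rw [← hlen, h2] at this
  simp at this

theorem encard_neighborSet (hH : ∀ x y, H.Adj x y ↔ ∃ k, letterShift k x = y)
    (x : freePart (FreeGroup α) X) : (H.neighborSet x).encard = ENat.card (α × Bool) := by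
  have : H.neighborSet x = (fun k => letterShift k x) '' Set.univ := by
    ext y
    simp [hH]
  rw [this, (letterShift_left_injective x).encard_image, Set.encard_univ]

end FreeGroup

theorem borelChromaticNumber_eq {n : ℕ} {X : Type} [MeasurableSpace X] {G : X → X → Prop}
    (hub : ∃ c : X → Fin (n + 1), Measurable c ∧ ∀ x y, G x y → c x ≠ c y)
    (hlb : ∀ c : X → Fin n, (∀ k, MeasurableSet (c ⁻¹' {k})) → ∃ x y, G x y ∧ c x = c y) :
    borelChromaticNumber G = ((n + 1 : ℕ) : Cardinal) := by
  have hmem : ((n + 1 : ℕ) : Cardinal) ∈ {κ : Cardinal | ∃ (Y : Type) (mY : MeasurableSpace Y),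
      @StandardBorelSpace Y mY ∧ Cardinal.mk Y = κ ∧
      ∃ c : X → Y, @Measurable X Y _ mY c ∧ ∀ x y, G x y → c x ≠ c y} :=
    ⟨Fin (n + 1), inferInstance, inferInstance, Cardinal.mk_fin _, hub⟩
  refine le_antisymm (csInf_le' hmem) (le_csInf ⟨_, hmem⟩ ?_)
  rintro _ ⟨Y, mY, hY, rfl, c, hc, hcol⟩
  by_contra! hlt
  obtain ⟨m, hm⟩ := Cardinal.lt_aleph0.1 (hlt.trans (Cardinal.natCast_lt_aleph0))
  have hle : Cardinal.mk Y ≤ Cardinal.mk (Fin n) := by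
    rw [hm, Nat.cast_lt] at hlt
    rw [hm, Cardinal.mk_fin, Nat.cast_le]
    omega
  obtain ⟨e⟩ := Cardinal.le_def _ _ |>.1 hle
  have : Finite Y := Finite.of_injective e e.injective
  obtain ⟨x, y, hxy, h⟩ := hlb (e ∘ c) fun k => hc (Set.toFinite (e ⁻¹' {k})).measurableSet
  exact hcol x y hxy (e.injective h)

/-- For every `n ≥ 1`, the graph `G(F_n, ℕ)`, where `F_n` is the free group on `n`
generators with its standard marking, is a `2n`-regular acyclic Borel graph with Borel
chromatic number `2n + 1`. -/
theorem stmt_4 (n : ℕ) (hn : 1 ≤ n)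
    (H : SimpleGraph ↥(freePart (FreeGroup (Fin n)) ℕ))
    (hH : ∀ x y, H.Adj x y ↔
      cayleyAdj (Set.range (FreeGroup.of : Fin n → FreeGroup (Fin n))) ℕ x y) :
    MeasurableSet {p : ↥(freePart (FreeGroup (Fin n)) ℕ) × ↥(freePart (FreeGroup (Fin n)) ℕ) |
      H.Adj p.1 p.2} ∧
    (∀ x, (H.neighborSet x).encard = 2 * n) ∧
    H.IsAcyclic ∧
    borelChromaticNumber H.Adj = ((2 * n + 1 : ℕ) : Cardinal) := by
  have : Countable (FreeGroup (Fin n)) := FreeGroup.toWord_injective.countable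
  have hH' : ∀ x y, H.Adj x y ↔ ∃ k, FreeGroup.letterShift k x = y := fun x y =>
    (hH x y).trans FreeGroup.cayleyAdj_iff
  refine ⟨?_, fun x => ?_, FreeGroup.isAcyclic_of_adj_iff hH', borelChromaticNumber_eq ?_ ?_⟩
  · simp only [hH']
    exact measurableSet_exists fun k => measurableSet_eq_fun
      ((FreeGroup.measurable_letterShift k).comp measurable_fst) measurable_snd
  · rw [FreeGroup.encard_neighborSet hH']
    simp [mul_comm]
  · obtain ⟨c, hc, hcol⟩ := exists_measurable_coloring
      (FreeGroup.measurable_letterShift (α := Fin n)) FreeGroup.letterShift_ne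
      fun k => ⟨_, FreeGroup.letterShift_not k⟩
    have hcard : Fintype.card (Fin n × Bool) + 1 = 2 * n + 1 := by simp [mul_comm]
    rw [← hcard]
    refine ⟨c, hc, fun x y hxy => ?_⟩
    obtain ⟨k, rfl⟩ := (hH' x y).1 hxy
    exact (hcol k x).symm
  · intro c hc
    let e : Fin (2 * n) ≃ Fin n × Bool := Fintype.equivOfCardEq (by simp [mul_comm])
    obtain ⟨x, y, hxy, h⟩ := not_coloring (c := e ∘ c) fun k => by
      have : e ∘ c ⁻¹' {k} = c ⁻¹' {e.symm k} := by
        ext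
        simp [e.eq_symm_apply]
      exact this ▸ hc _
    exact ⟨x, y, (hH x y).2 hxy, e.injective h⟩
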